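/- arXiv:2001.02119 — 4 statements merged into one kernel-verified Lean document; each statement's English description precedes it below -/
import Mathlib

section
/- Let r > 0, let γ : ℝ → ℝ² be a smooth unit-speed plane curve, let N ∈ ℕ, let U ⊆ ℝ² be an open set containing the set A := ⋃_{s∈ℝ} C_s where C_s := {x ∈ ℝ² : |x − γ(s)| = r}, and let F : U → ℝ be C^∞. Suppose that for every s ∈ ℝ there exists a real polynomial p_s in two variables of total degree at most N such that F(x) = p_s(x) for all x ∈ C_s. Then there exists a real polynomial P in two variables of total degree at most 2N such that F(x) = P(x) for all x ∈ A. -/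
open Real

theorem iter_swap {E V : Type*} [NormedAddCommGroup E] [NormedSpace ℝ E]
    [NormedAddCommGroup V] [NormedSpace ℝ V] {U : Set E} (hU : IsOpen U)
    {F : E → V} (hF : ContDiffOn ℝ (⊤ : ℕ∞) F U) :
    ∀ (n : ℕ) (i : Fin n) (x : E), x ∈ U → ∀ v : Fin (n + 1) → E,
      iteratedFDeriv ℝ (n + 1) F x (v ∘ Equiv.swap i.castSucc i.succ)
        = iteratedFDeriv ℝ (n + 1) F x v := by
  have hFat : ∀ x ∈ U, ContDiffAt ℝ (⊤ : ℕ∞) F x := fun x hx => hF.contDiffAt (hU.mem_nhds hx)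
  have hd : ∀ (n : ℕ), ∀ x ∈ U, DifferentiableAt ℝ (iteratedFDeriv ℝ n F) x := fun n x hx =>
    (hFat x hx).differentiableAt_iteratedFDeriv (by exact_mod_cast ENat.natCast_lt_top n)
  intro n
  induction n with
  | zero => intro i; exact i.elim0
  | succ n ih =>
    have hg : ∀ x ∈ U, ∀ m : Fin (n + 1) → E, HasFDerivAt (fun y => iteratedFDeriv ℝ (n + 1) F y m)
        ((ContinuousMultilinearMap.apply ℝ (fun _ : Fin (n + 1) => E) V m).comp
          (fderiv ℝ (iteratedFDeriv ℝ (n + 1) F) x)) x := fun x hx m =>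
      (ContinuousMultilinearMap.apply ℝ (fun _ : Fin (n + 1) => E) V m).hasFDerivAt.comp x
        (hd (n + 1) x hx).hasFDerivAt
    intro i x hx v
    induction i using Fin.cases with
    | zero =>
      have hc : ContDiffAt ℝ 2 (iteratedFDeriv ℝ n F) x :=
        (hFat x hx).iteratedFDeriv_right (m := 2) (i := n)
          (WithTop.coe_le_coe.2 (le_top : ((2 : ℕ∞) + n) ≤ ⊤))
      have key : ∀ w : Fin (n + 2) → E, iteratedFDeriv ℝ (n + 2) F x w
          = fderiv ℝ (fderiv ℝ (iteratedFDeriv ℝ n F)) x (w 0) (w 1) (Fin.tail (Fin.tail w)) := by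
        intro w
        rw [iteratedFDeriv_succ_apply_left]
        have h2 : DifferentiableAt ℝ (fderiv ℝ (iteratedFDeriv ℝ n F)) x := by
          have h := hc.fderiv_right (m := 1) (by norm_num)
          exact h.differentiableAt (by simp)
        have h3 := hg x hx (Fin.tail w)
        have h5 : HasFDerivAt (fun y => fderiv ℝ (iteratedFDeriv ℝ n F) y (w 1))
            ((fderiv ℝ (fderiv ℝ (iteratedFDeriv ℝ n F)) x).flip (w 1)) x := by
          simpa using h2.hasFDerivAt.clm_apply (hasFDerivAt_const (w 1) x)
        have h4 := (ContinuousMultilinearMap.apply ℝ (fun _ : Fin n => E) V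
          (Fin.tail (Fin.tail w))).hasFDerivAt.comp x h5
        exact DFunLike.congr_fun (h3.unique (h4.congr_of_eventuallyEq (by
          filter_upwards with y
          rw [iteratedFDeriv_succ_apply_left]
          rfl))) (w 0)
      rw [key, key]
      have hs : IsSymmSndFDerivAt ℝ (iteratedFDeriv ℝ n F) x := by
        exact hc.isSymmSndFDerivAt (by simp)
      have e0 : (v ∘ Equiv.swap (Fin.castSucc (0 : Fin (n + 1))) (Fin.succ 0)) 0 = v 1 := by
        simp
      have e1 : (v ∘ Equiv.swap (Fin.castSucc (0 : Fin (n + 1))) (Fin.succ 0)) 1 = v 0 := by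
        simp
      have e2 : Fin.tail (Fin.tail (v ∘ Equiv.swap (Fin.castSucc (0 : Fin (n + 1))) (Fin.succ 0)))
          = Fin.tail (Fin.tail v) := by
        ext1 j
        simp only [Fin.tail, Function.comp]
        rw [Equiv.swap_apply_of_ne_of_ne]
        · exact Fin.succ_ne_zero _
        · intro h; exact Fin.succ_ne_zero _ (Fin.succ_injective _ h)
      rw [e0, e1, e2, hs.eq]
    | succ j =>
      rw [iteratedFDeriv_succ_apply_left, iteratedFDeriv_succ_apply_left]
      have e0 : (v ∘ Equiv.swap (Fin.castSucc (Fin.succ j)) (Fin.succ (Fin.succ j))) 0 = v 0 := by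
        simp only [Function.comp]
        rw [Equiv.swap_apply_of_ne_of_ne]
        · rw [Fin.castSucc_succ]; exact (Fin.succ_ne_zero _).symm
        · exact (Fin.succ_ne_zero _).symm
      have e1 : Fin.tail (v ∘ Equiv.swap (Fin.castSucc (Fin.succ j)) (Fin.succ (Fin.succ j)))
          = Fin.tail v ∘ Equiv.swap j.castSucc j.succ := by
        ext1 k
        simp only [Fin.tail, Function.comp, Fin.castSucc_succ]
        congr 1
        exact ((Fin.succ_injective (n + 1)).swap_apply _ _ _)
      rw [e0, e1]
      have h1 := hg x hx (Fin.tail v ∘ Equiv.swap j.castSucc j.succ)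
      have h2 := hg x hx (Fin.tail v)
      have h3 := h1.unique (h2.congr_of_eventuallyEq (by
        filter_upwards [hU.mem_nhds hx] with y hy
        exact ih j y hy (Fin.tail v)))
      exact DFunLike.congr_fun h3 (v 0)

theorem iter_perm {E V : Type*} [NormedAddCommGroup E] [NormedSpace ℝ E]
    [NormedAddCommGroup V] [NormedSpace ℝ V] {U : Set E} (hU : IsOpen U)
    {F : E → V} (hF : ContDiffOn ℝ (⊤ : ℕ∞) F U) (n : ℕ) (σ : Equiv.Perm (Fin n))
    (x : E) (hx : x ∈ U) (v : Fin n → E) :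
      iteratedFDeriv ℝ n F x (fun i => v (σ i)) = iteratedFDeriv ℝ n F x v := by
  cases n with
  | zero => congr 1; ext1 i; exact i.elim0
  | succ n =>
    have hσ : σ ∈ Submonoid.closure
        (Set.range fun i : Fin n => Equiv.swap i.castSucc i.succ) := by
      rw [Equiv.Perm.mclosure_swap_castSucc_succ]; trivial
    induction hσ using Submonoid.closure_induction generalizing v with
    | mem τ hτ =>
      obtain ⟨i, rfl⟩ := hτ
      exact iter_swap hU hF n i x hx v
    | one => rfl
    | mul a b _ _ ha hb =>
      have h1 := hb (fun i => v (a i))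
      rw [ha v] at h1
      exact h1

/-- The unit circle. -/
noncomputable def uu (φ : ℝ) : EuclideanSpace ℝ (Fin 2) := !₂[cos φ, sin φ]

/-- Its derivative. -/
noncomputable def uu' (φ : ℝ) : EuclideanSpace ℝ (Fin 2) := !₂[-sin φ, cos φ]

theorem hasDerivAt_uu (φ : ℝ) : HasDerivAt uu (uu' φ) φ := by
  have h : HasDerivAt (fun φ : ℝ => (![cos φ, sin φ] : Fin 2 → ℝ)) ![-sin φ, cos φ] φ := by
    rw [hasDerivAt_pi]
    intro i
    fin_cases i
    · exact hasDerivAt_cos φ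
    · exact hasDerivAt_sin φ
  exact ((EuclideanSpace.equiv (Fin 2) ℝ).symm.toContinuousLinearMap.hasFDerivAt.comp_hasDerivAt φ h)

theorem norm_uu (φ : ℝ) : ‖uu φ‖ = 1 := by
  simp [EuclideanSpace.norm_eq, uu, Fin.sum_univ_two]

theorem mem_sphere_pt {c : EuclideanSpace ℝ (Fin 2)} {r : ℝ} (hr : 0 < r) (φ : ℝ) :
    c + r • uu φ ∈ Metric.sphere c r := by
  simp [norm_smul, norm_uu, abs_of_pos hr]

theorem exists_pt {c x : EuclideanSpace ℝ (Fin 2)} {r : ℝ} (hr : 0 < r)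
    (hx : x ∈ Metric.sphere c r) : ∃ φ, x = c + r • uu φ := by
  have h1 : ‖x - c‖ = r := by simpa [dist_eq_norm] using hx
  set z : ℂ := ⟨(x - c) 0, (x - c) 1⟩ with hz
  have hzn : ‖z‖ = r := by
    rw [← h1, EuclideanSpace.norm_eq, Complex.norm_eq_sqrt_sq_add_sq]
    simp [Fin.sum_univ_two, hz]
  refine ⟨z.arg, ?_⟩
  have hz0 : z ≠ 0 := by intro h; rw [h] at hzn; simp at hzn; linarith
  have hc := Complex.cos_arg hz0
  have hs := Complex.sin_arg z
  rw [hzn] at hc hs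
  have hc2 : r * cos z.arg = x 0 - c 0 := by
    rw [hc]; change r * ((x - c) 0 / r) = _; field_simp; rfl
  have hs2 : r * sin z.arg = x 1 - c 1 := by
    rw [hs]; change r * ((x - c) 1 / r) = _; field_simp; rfl
  clear_value z
  ext i
  fin_cases i
  · simp [uu, hc2]
  · simp [uu, hs2]

theorem const_on_A {V : Type*} [NormedAddCommGroup V] [NormedSpace ℝ V]
    (r : ℝ) (γ : ℝ → EuclideanSpace ℝ (Fin 2)) (hγ : Differentiable ℝ γ)
    (K : EuclideanSpace ℝ (Fin 2) → V)
    (hK : ∀ s φ, HasFDerivAt K (0 : EuclideanSpace ℝ (Fin 2) →L[ℝ] V) (γ s + r • uu φ)) :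
    ∀ s φ, K (γ s + r • uu φ) = K (γ 0 + r • uu 0) := by
  have h1 : ∀ s φ, HasDerivAt (fun φ => K (γ s + r • uu φ)) 0 φ := fun s φ => by
    simpa [Function.comp_def] using (hK s φ).comp_hasDerivAt φ (((hasDerivAt_uu φ).const_smul r).const_add (γ s))
  have h2 : ∀ s φ, HasDerivAt (fun s => K (γ s + r • uu φ)) 0 s := fun s φ => by
    simpa [Function.comp_def] using (hK s φ).comp_hasDerivAt s ((hγ s).hasDerivAt.add_const (r • uu φ))
  intro s φ
  have e1 := is_const_of_deriv_eq_zero (fun φ => (h1 s φ).differentiableAt)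
    (fun φ => (h1 s φ).deriv) φ 0
  have e2 := is_const_of_deriv_eq_zero (fun s => (h2 s 0).differentiableAt)
    (fun s => (h2 s 0).deriv) s 0
  exact e1.trans e2

theorem diag_poly {n : ℕ} (c : ContinuousMultilinearMap ℝ (fun _ : Fin n => EuclideanSpace ℝ (Fin 2)) ℝ) :
    ∃ P : MvPolynomial (Fin 2) ℝ, P.totalDegree ≤ n ∧
      ∀ x : EuclideanSpace ℝ (Fin 2), c (fun _ => x) = MvPolynomial.eval (fun i => x i) P := by
  refine ⟨∑ f : Fin n → Fin 2, MvPolynomial.C (c fun i => EuclideanSpace.single (f i) (1 : ℝ)) *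
    ∏ i, MvPolynomial.X (f i), ?_, ?_⟩
  · refine (MvPolynomial.totalDegree_finsetSum _ _).trans (Finset.sup_le fun f _ => ?_)
    refine (MvPolynomial.totalDegree_mul _ _).trans ?_
    rw [MvPolynomial.totalDegree_C, zero_add]
    refine (MvPolynomial.totalDegree_finsetProd _ _).trans ?_
    simp
  · intro x
    have hx : x = ∑ j : Fin 2, x j • EuclideanSpace.single j (1 : ℝ) := by
      ext i; fin_cases i <;> simp [Fin.sum_univ_two]
    conv_lhs => rw [hx]
    rw [c.map_sum (fun (_ : Fin n) (j : Fin 2) => x j • EuclideanSpace.single j (1 : ℝ))]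
    simp only [map_sum, map_mul, MvPolynomial.eval_C, map_prod, MvPolynomial.eval_X]
    refine Finset.sum_congr rfl fun f _ => ?_
    rw [c.map_smul_univ]
    simp [mul_comm]

theorem integrate (r : ℝ) (γ : ℝ → EuclideanSpace ℝ (Fin 2)) (hγ : Differentiable ℝ γ)
    {U : Set (EuclideanSpace ℝ (Fin 2))} (hU : IsOpen U)
    (hA : ∀ s φ, γ s + r • uu φ ∈ U) :
    ∀ (n : ℕ) (F : EuclideanSpace ℝ (Fin 2) → ℝ), ContDiffOn ℝ (⊤ : ℕ∞) F U →
      (∀ s φ, iteratedFDeriv ℝ (n + 1) F (γ s + r • uu φ) = 0) →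
      ∃ P : MvPolynomial (Fin 2) ℝ, P.totalDegree ≤ n ∧
        ∀ s φ, F (γ s + r • uu φ) = MvPolynomial.eval (fun i => (γ s + r • uu φ) i) P := by
  have step : ∀ (n : ℕ) (F : EuclideanSpace ℝ (Fin 2) → ℝ), ContDiffOn ℝ (⊤ : ℕ∞) F U →
      (∀ s φ, iteratedFDeriv ℝ (n + 1) F (γ s + r • uu φ) = 0) →
      ∃ (G : EuclideanSpace ℝ (Fin 2) → ℝ) (P : MvPolynomial (Fin 2) ℝ), P.totalDegree ≤ n ∧
        ContDiffOn ℝ (⊤ : ℕ∞) G U ∧ (∀ s φ, iteratedFDeriv ℝ n G (γ s + r • uu φ) = 0) ∧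
        ∀ x, F x = G x + MvPolynomial.eval (fun i => x i) P := by
    intro n F hF h0
    have hFat : ∀ x ∈ U, ContDiffAt ℝ (⊤ : ℕ∞) F x := fun x hx => hF.contDiffAt (hU.mem_nhds hx)
    have hconst := const_on_A r γ hγ (iteratedFDeriv ℝ n F) (fun s φ => by
      have hd : DifferentiableAt ℝ (iteratedFDeriv ℝ n F) (γ s + r • uu φ) :=
        (hFat _ (hA s φ)).differentiableAt_iteratedFDeriv
          (by exact_mod_cast ENat.natCast_lt_top n)
      have hz : fderiv ℝ (iteratedFDeriv ℝ n F) (γ s + r • uu φ) = 0 := by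
        refine ContinuousLinearMap.ext fun v => ContinuousMultilinearMap.ext fun m => ?_
        have := DFunLike.congr_fun (h0 s φ) (Fin.cons v m)
        rw [iteratedFDeriv_succ_apply_left] at this
        simpa using this
      rw [← hz]
      exact hd.hasFDerivAt)
    set c := iteratedFDeriv ℝ n F (γ 0 + r • uu 0) with hc
    set c' : ContinuousMultilinearMap ℝ (fun _ : Fin n => EuclideanSpace ℝ (Fin 2)) ℝ :=
      ((n.factorial : ℝ)⁻¹) • c with hc'
    obtain ⟨P, hP, hPe⟩ := diag_poly c'
    have hQ : ContDiff ℝ (⊤ : ℕ∞) (fun x : EuclideanSpace ℝ (Fin 2) => c' (fun _ => x)) :=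
      c'.contDiff.comp (contDiff_pi.2 fun _ => contDiff_id)
    refine ⟨F - fun x => c' (fun _ => x), P, hP, hF.sub hQ.contDiffOn, ?_, ?_⟩
    · intro s φ
      have hn : ((n : ℕ) : WithTop ℕ∞) ≤ ((⊤ : ℕ∞) : WithTop ℕ∞) :=
        WithTop.coe_le_coe.2 (le_top : (n : ℕ∞) ≤ ⊤)
      rw [iteratedFDeriv_sub_apply ((hFat _ (hA s φ)).of_le hn) (hQ.contDiffAt.of_le hn), hconst,
        sub_eq_zero]
      ext v
      rw [ContinuousMultilinearMap.iteratedFDeriv_comp_diagonal]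
      have : ∀ σ : Equiv.Perm (Fin n), c' (fun i => v (σ i)) = (n.factorial : ℝ)⁻¹ * c v := by
        intro σ
        rw [hc', _root_.smul_apply, smul_eq_mul, hc, iter_perm hU hF n σ _ (hA 0 0)]
      rw [Finset.sum_congr rfl (fun σ _ => this σ)]
      simp [Fintype.card_perm]
      field_simp
    · intro x
      simp [← hPe]
  intro n
  induction n with
  | zero =>
    intro F hF h0
    obtain ⟨G, P, hP, hG, hG0, hFG⟩ := step 0 F hF h0
    refine ⟨P, hP, fun s φ => ?_⟩
    have := DFunLike.congr_fun (hG0 s φ) 0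
    rw [iteratedFDeriv_zero_apply] at this
    rw [hFG, this]; simp
  | succ n ih =>
    intro F hF h0
    obtain ⟨G, P, hP, hG, hG0, hFG⟩ := step (n + 1) F hF h0
    obtain ⟨P', hP', hP'e⟩ := ih G hG hG0
    refine ⟨P' + P, (MvPolynomial.totalDegree_add _ _).trans (max_le (hP'.trans (by omega)) hP), ?_⟩
    intro s φ
    rw [hFG, hP'e, map_add]

/-- The point of the unit circle in the complex plane. -/
noncomputable def ww (φ : ℝ) : ℂ := Complex.exp (φ * Complex.I)

theorem ww_ne (φ : ℝ) : ww φ ≠ 0 := Complex.exp_ne_zero _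

theorem hasDerivAt_ww (φ : ℝ) : HasDerivAt ww (Complex.I * ww φ) φ := by
  have h : HasDerivAt (fun φ : ℝ => (φ : ℂ) * Complex.I) Complex.I φ := by
    simpa using (Complex.ofRealCLM.hasDerivAt (x := φ)).mul_const Complex.I
  have := h.cexp
  rw [mul_comm] at this
  exact this

theorem continuous_ww : Continuous ww :=
  continuous_iff_continuousAt.2 fun φ => (hasDerivAt_ww φ).continuousAt

theorem exists_ww {a : ℂ} (ha : ‖a‖ = 1) : ∃ φ, ww φ = a := by
  refine ⟨a.arg, ?_⟩
  have := Complex.norm_mul_exp_arg_mul_I a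
  rw [ha] at this
  simpa [ww] using this

/-- Evaluation of `w ^ p * Q(w)` along the circle. -/
noncomputable def trigL (p : ℤ) : Polynomial ℂ →ₗ[ℂ] (ℝ → ℂ) where
  toFun Q := fun φ => ww φ ^ p * Q.eval (ww φ)
  map_add' Q R := by ext φ; simp [mul_add]
  map_smul' c Q := by ext φ; simp; ring

/-- Trigonometric polynomials with exponents in `[p, p + n)`. -/
noncomputable def TP (p : ℤ) (n : ℕ) : Submodule ℂ (ℝ → ℂ) :=
  (Polynomial.degreeLT ℂ n).map (trigL p)

theorem mem_TP {p : ℤ} {n : ℕ} {h : ℝ → ℂ} :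
    h ∈ TP p n ↔ ∃ Q : Polynomial ℂ, Q.degree < n ∧ ∀ φ, h φ = ww φ ^ p * Q.eval (ww φ) := by
  constructor
  · rintro ⟨Q, hQ, rfl⟩
    exact ⟨Q, Polynomial.mem_degreeLT.1 hQ, fun φ => rfl⟩
  · rintro ⟨Q, hQ, h⟩
    exact ⟨Q, Polynomial.mem_degreeLT.2 hQ, by ext φ; exact (h φ).symm⟩

theorem isClosed_TP (p : ℤ) (n : ℕ) : IsClosed (TP p n : Set (ℝ → ℂ)) := by
  have : FiniteDimensional ℂ (TP p n) := by unfold TP; infer_instance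
  exact Submodule.closed_of_finiteDimensional _

theorem TP_deriv_param {p : ℤ} {n : ℕ} {G : ℝ → ℝ → ℂ} (hG : ∀ s, G s ∈ TP p n) (s : ℝ)
    {g : ℝ → ℂ} (hg : ∀ φ, HasDerivAt (fun s => G s φ) (g φ) s) : g ∈ TP p n := by
  have h : Filter.Tendsto (fun s' => slope G s s') (nhdsWithin s {s}ᶜ) (nhds g) := by
    rw [tendsto_pi_nhds]
    intro φ
    have := hasDerivAt_iff_tendsto_slope.1 (hg φ)
    refine this.congr fun s' => ?_
    simp [slope_def_module]
  refine (isClosed_TP p n).mem_of_tendsto h (Filter.Eventually.of_forall fun s' => ?_)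
  rw [slope_def_module]
  have h2 := (TP p n).smul_mem (((s' - s)⁻¹ : ℝ) : ℂ) ((TP p n).sub_mem (hG s') (hG s))
  have e : (s' - s)⁻¹ • (G s' - G s) = (((s' - s)⁻¹ : ℝ) : ℂ) • (G s' - G s) := by
    ext φ; simp
  rw [e]; exact h2

theorem degree_C_mul_le_aux (a : ℂ) (q : Polynomial ℂ) :
    (Polynomial.C a * q).degree ≤ q.degree := by
  rw [← Polynomial.smul_eq_C_mul]; exact Polynomial.degree_smul_le a q

theorem TP_deriv {p : ℤ} {n : ℕ} {h g : ℝ → ℂ} (hh : h ∈ TP p n)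
    (hg : ∀ φ, HasDerivAt h (g φ) φ) : g ∈ TP p n := by
  obtain ⟨Q, hQ, hQe⟩ := mem_TP.1 hh
  refine mem_TP.2 ⟨Polynomial.C Complex.I * (Polynomial.C (p : ℂ) * Q
    + Polynomial.X * Polynomial.derivative Q), ?_, fun φ => ?_⟩
  · refine (degree_C_mul_le_aux _ _).trans_lt ?_
    refine (Polynomial.degree_add_le _ _).trans_lt (max_lt ?_ ?_)
    · exact (degree_C_mul_le_aux _ _).trans_lt hQ
    · refine lt_of_le_of_lt ?_ hQ
      by_cases h0 : Q.natDegree = 0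
      · rw [Polynomial.eq_C_of_natDegree_eq_zero h0]; simp
      · have h1 : Q ≠ 0 := by rintro rfl; simp at h0
        have h2 := Polynomial.natDegree_derivative_lt h0
        rw [Polynomial.degree_eq_natDegree h1]
        refine Polynomial.degree_le_of_natDegree_le ?_
        refine Polynomial.natDegree_mul_le.trans ?_
        rw [Polynomial.natDegree_X]; omega
  · have h1 : HasDerivAt h (((p : ℂ) * ww φ ^ (p - 1)) * (Complex.I * ww φ) * Q.eval (ww φ)
        + ww φ ^ p * (Q.derivative.eval (ww φ) * (Complex.I * ww φ))) φ := by
      have e : h = fun φ => ww φ ^ p * Q.eval (ww φ) := funext hQe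
      rw [e]
      exact ((hasDerivAt_zpow p (ww φ) (Or.inl (ww_ne φ))).comp φ (hasDerivAt_ww φ)).mul
        ((Q.hasDerivAt (ww φ)).comp φ (hasDerivAt_ww φ))
    rw [(hg φ).unique h1, zpow_sub_one₀ (ww_ne φ)]
    have := ww_ne φ
    simp
    field_simp

theorem TP_divide {p : ℤ} {n : ℕ} {H : ℝ → ℂ} (hH : Continuous H) {t : ℂ} (ht : ‖t‖ = 1)
    {R : Polynomial ℂ} (hR : R.degree < ((n + 1 : ℕ) : WithBot ℕ))
    (hRe : ∀ φ, (ww φ ^ 2 + t ^ 2) * H φ = ww φ ^ p * R.eval (ww φ)) :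
    H ∈ TP p (n - 1) := by
  have hI : Complex.I ^ 2 = -1 := Complex.I_sq
  have ht0 : t ≠ 0 := by rintro rfl; simp at ht
  have hroot : ∀ a : ℂ, ‖a‖ = 1 → a ^ 2 + t ^ 2 = 0 → R.IsRoot a := by
    intro a ha h0
    obtain ⟨φ, rfl⟩ := exists_ww ha
    have := hRe φ
    rw [h0, zero_mul] at this
    have h2 := zpow_ne_zero p (ww_ne φ)
    exact (mul_eq_zero.1 this.symm).resolve_left h2
  have r1 := hroot (Complex.I * t) (by simp [ht]) (by linear_combination t ^ 2 * hI)
  have r2 := hroot (-(Complex.I * t)) (by simp [ht]) (by linear_combination t ^ 2 * hI)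
  have hcop : IsCoprime (Polynomial.X - Polynomial.C (Complex.I * t))
      (Polynomial.X - Polynomial.C (-(Complex.I * t))) := by
    apply Polynomial.isCoprime_X_sub_C_of_isUnit_sub
    rw [isUnit_iff_ne_zero]
    intro h
    have : 2 * (Complex.I * t) = 0 := by linear_combination h
    simp [ht0] at this
  obtain ⟨Q, hQ⟩ := hcop.mul_dvd (Polynomial.dvd_iff_isRoot.2 r1) (Polynomial.dvd_iff_isRoot.2 r2)
  have hdeg : Q.degree < ((n - 1 : ℕ) : WithBot ℕ) := by
    by_cases hQ0 : Q = 0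
    · rw [hQ0, Polynomial.degree_zero]; exact WithBot.bot_lt_coe _
    · rw [hQ, Polynomial.degree_mul, Polynomial.degree_mul, Polynomial.degree_X_sub_C,
        Polynomial.degree_X_sub_C, Polynomial.degree_eq_natDegree hQ0] at hR
      rw [Polynomial.degree_eq_natDegree hQ0]
      norm_cast at hR ⊢
      omega
  have hev : ∀ φ, R.eval (ww φ) = (ww φ ^ 2 + t ^ 2) * Q.eval (ww φ) := by
    intro φ
    rw [hQ]
    simp only [Polynomial.eval_mul, Polynomial.eval_sub, Polynomial.eval_X, Polynomial.eval_C]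
    linear_combination (-t ^ 2 * Q.eval (ww φ)) * hI
  have hgen : ∀ φ, ww φ ^ 2 + t ^ 2 ≠ 0 → H φ = ww φ ^ p * Q.eval (ww φ) := by
    intro φ h0
    have := hRe φ
    rw [hev φ] at this
    apply mul_left_cancel₀ h0
    rw [this]; ring
  refine mem_TP.2 ⟨Q, hdeg, fun φ => ?_⟩
  have hd : HasDerivAt (fun φ => ww φ ^ 2 + t ^ 2) (2 * ww φ * (Complex.I * ww φ)) φ := by
    simpa using ((hasDerivAt_ww φ).pow 2).add_const (t ^ 2)
  have hne : 2 * ww φ * (Complex.I * ww φ) ≠ 0 := by simp [ww_ne]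
  have hev2 := hd.eventually_ne (c := 0) hne
  have c2 : ContinuousAt (fun φ => ww φ ^ p * Q.eval (ww φ)) φ :=
    (continuous_ww.continuousAt.zpow₀ p (Or.inl (ww_ne φ))).mul
      (Q.continuous.comp continuous_ww).continuousAt
  have l1 : Filter.Tendsto H (nhdsWithin φ {φ}ᶜ) (nhds (H φ)) :=
    hH.continuousAt.tendsto.mono_left nhdsWithin_le_nhds
  have l2 := c2.tendsto.mono_left (nhdsWithin_le_nhds (s := {φ}ᶜ))
  refine tendsto_nhds_unique l1 (l2.congr' ?_)
  filter_upwards [hev2] with ψ hψ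
  exact (hgen ψ hψ).symm

/-- The coordinate `z`. -/
noncomputable def dz : EuclideanSpace ℝ (Fin 2) →L[ℝ] ℂ :=
  Complex.ofRealCLM.comp (EuclideanSpace.proj 0) +
    Complex.I • Complex.ofRealCLM.comp (EuclideanSpace.proj 1)

/-- The coordinate `conj z`. -/
noncomputable def dzb : EuclideanSpace ℝ (Fin 2) →L[ℝ] ℂ :=
  Complex.ofRealCLM.comp (EuclideanSpace.proj 0) -
    Complex.I • Complex.ofRealCLM.comp (EuclideanSpace.proj 1)

theorem dz_apply (x : EuclideanSpace ℝ (Fin 2)) : dz x = (x 0 : ℂ) + Complex.I * (x 1 : ℂ) := by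
  simp [dz]

theorem dzb_apply (x : EuclideanSpace ℝ (Fin 2)) : dzb x = (x 0 : ℂ) - Complex.I * (x 1 : ℂ) := by
  simp [dzb]

/-- The derivative in `z`. -/
noncomputable def Dz (H : EuclideanSpace ℝ (Fin 2) → ℂ) (x : EuclideanSpace ℝ (Fin 2)) : ℂ :=
  (1 / 2 : ℂ) * (fderiv ℝ H x (EuclideanSpace.single 0 1)
    - Complex.I * fderiv ℝ H x (EuclideanSpace.single 1 1))

/-- The derivative in `conj z`. -/
noncomputable def Dzb (H : EuclideanSpace ℝ (Fin 2) → ℂ) (x : EuclideanSpace ℝ (Fin 2)) : ℂ :=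
  (1 / 2 : ℂ) * (fderiv ℝ H x (EuclideanSpace.single 0 1)
    + Complex.I * fderiv ℝ H x (EuclideanSpace.single 1 1))

theorem fderiv_split (H : EuclideanSpace ℝ (Fin 2) → ℂ) (x v : EuclideanSpace ℝ (Fin 2)) :
    fderiv ℝ H x v = Dz H x * dz v + Dzb H x * dzb v := by
  have hv : v = v 0 • EuclideanSpace.single 0 (1 : ℝ) + v 1 • EuclideanSpace.single 1 (1 : ℝ) := by
    ext i; fin_cases i <;> simp
  conv_lhs => rw [hv]
  rw [map_add, map_smul, map_smul, dz_apply, dzb_apply, Dz, Dzb]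
  simp only [Complex.real_smul]
  have hI : Complex.I ^ 2 = -1 := Complex.I_sq
  linear_combination ((v 1 : ℂ) * fderiv ℝ H x (EuclideanSpace.single 1 1)) * hI

theorem dz_uu' (φ : ℝ) : dz (uu' φ) = Complex.I * ww φ := by
  have hI : Complex.I ^ 2 = -1 := Complex.I_sq
  rw [dz_apply, ww, Complex.exp_mul_I]
  simp [uu']
  linear_combination (-Complex.sin φ) * hI

theorem dzb_uu' (φ : ℝ) : ww φ * dzb (uu' φ) = -Complex.I := by
  have hI : Complex.I ^ 2 = -1 := Complex.I_sq
  have h1 := Complex.sin_sq_add_cos_sq (φ : ℂ)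
  rw [dzb_apply, ww, Complex.exp_mul_I]
  simp [uu']
  linear_combination (-Complex.I) * h1 - (Complex.sin φ * Complex.cos φ + 0) * hI

theorem dz_mul_dzb (x : EuclideanSpace ℝ (Fin 2)) : dz x * dzb x = (‖x‖ : ℂ) ^ 2 := by
  have hI : Complex.I ^ 2 = -1 := Complex.I_sq
  have h : ‖x‖ ^ 2 = x 0 ^ 2 + x 1 ^ 2 := by
    rw [EuclideanSpace.norm_sq_eq]; simp [Fin.sum_univ_two]
  have h' : (‖x‖ : ℂ) ^ 2 = (x 0 : ℂ) ^ 2 + (x 1 : ℂ) ^ 2 := by exact_mod_cast h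
  rw [dz_apply, dzb_apply, h']
  linear_combination (-(x 1 : ℂ) ^ 2) * hI

theorem norm_dz (x : EuclideanSpace ℝ (Fin 2)) : ‖dz x‖ = ‖x‖ := by
  rw [dz_apply, mul_comm, Complex.norm_add_mul_I, EuclideanSpace.norm_eq]
  simp [Fin.sum_univ_two]

theorem contDiffOn_Dz {U : Set (EuclideanSpace ℝ (Fin 2))} (hU : IsOpen U)
    {H : EuclideanSpace ℝ (Fin 2) → ℂ} (hH : ContDiffOn ℝ (⊤ : ℕ∞) H U) :
    ContDiffOn ℝ (⊤ : ℕ∞) (Dz H) U ∧ ContDiffOn ℝ (⊤ : ℕ∞) (Dzb H) U := by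
  have h := hH.fderiv_of_isOpen (m := (⊤ : ℕ∞)) hU (by simp)
  have h0 := h.clm_apply (contDiffOn_const (c := (EuclideanSpace.single 0 1 : EuclideanSpace ℝ (Fin 2))))
  have h1 := h.clm_apply (contDiffOn_const (c := (EuclideanSpace.single 1 1 : EuclideanSpace ℝ (Fin 2))))
  exact ⟨contDiffOn_const.mul (h0.sub (contDiffOn_const.mul h1)),
    contDiffOn_const.mul (h0.add (contDiffOn_const.mul h1))⟩

theorem degree_X_mul_lt_aux {n : ℕ} {q : Polynomial ℂ} (hq : q.degree < n) (a : ℂ) :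
    (Polynomial.C a * (Polynomial.X * q)).degree < ((n + 1 : ℕ) : WithBot ℕ) := by
  refine (degree_C_mul_le_aux _ _).trans_lt ?_
  by_cases h0 : q = 0
  · rw [h0, mul_zero, Polynomial.degree_zero]; exact WithBot.bot_lt_coe _
  · rw [Polynomial.degree_mul, Polynomial.degree_X, Polynomial.degree_eq_natDegree h0]
    rw [Polynomial.degree_eq_natDegree h0] at hq
    norm_cast at hq ⊢
    omega

theorem degree_C_mul_lt_aux {n : ℕ} {q : Polynomial ℂ} (hq : q.degree < n) (a : ℂ) :
    (Polynomial.C a * q).degree < ((n + 1 : ℕ) : WithBot ℕ) := by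
  refine (degree_C_mul_le_aux _ _).trans_lt (hq.trans ?_)
  norm_cast; omega

theorem class_step {r : ℝ} (hr : 0 < r) {γ : ℝ → EuclideanSpace ℝ (Fin 2)}
    (hγ : Differentiable ℝ γ) (hunit : ∀ s, ‖deriv γ s‖ = 1)
    {U : Set (EuclideanSpace ℝ (Fin 2))} (hU : IsOpen U)
    (hA : ∀ s φ, γ s + r • uu φ ∈ U)
    {H : EuclideanSpace ℝ (Fin 2) → ℂ} (hH : ContDiffOn ℝ (⊤ : ℕ∞) H U) {p : ℤ} {n : ℕ}
    (hT : ∀ s, (fun φ => H (γ s + r • uu φ)) ∈ TP p n) (s : ℝ) :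
    (fun φ => Dz H (γ s + r • uu φ)) ∈ TP p (n - 1) ∧
    (fun φ => Dzb H (γ s + r • uu φ)) ∈ TP (p + 1) (n - 1) := by
  have hd : ∀ s φ, HasFDerivAt H (fderiv ℝ H (γ s + r • uu φ)) (γ s + r • uu φ) := fun s φ =>
    ((hH.contDiffAt (hU.mem_nhds (hA s φ))).differentiableAt (by simp)).hasFDerivAt
  have hGs : (fun φ => fderiv ℝ H (γ s + r • uu φ) (deriv γ s)) ∈ TP p n :=
    TP_deriv_param (G := fun s φ => H (γ s + r • uu φ)) hT s (fun φ =>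
      (hd s φ).comp_hasDerivAt s ((hγ s).hasDerivAt.add_const (r • uu φ)))
  have hGφ : (fun φ => fderiv ℝ H (γ s + r • uu φ) (r • uu' φ)) ∈ TP p n :=
    TP_deriv (hT s) (fun φ =>
      (hd s φ).comp_hasDerivAt φ (((hasDerivAt_uu φ).const_smul r).const_add (γ s)))
  obtain ⟨A, hAd, hAe⟩ := mem_TP.1 hGs
  obtain ⟨B, hBd, hBe⟩ := mem_TP.1 hGφ
  have hcu : Continuous (fun φ => γ s + r • uu φ) := continuous_iff_continuousAt.2 fun φ =>
    (((hasDerivAt_uu φ).const_smul r).const_add (γ s)).continuousAt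
  have hC := contDiffOn_Dz hU hH
  have ht : ‖dz (deriv γ s)‖ = 1 := by rw [norm_dz, hunit]
  have htb : dz (deriv γ s) * dzb (deriv γ s) = 1 := by rw [dz_mul_dzb, hunit]; simp
  have hr' : (r : ℂ) ≠ 0 := by exact_mod_cast hr.ne'
  have hI : Complex.I ^ 2 = -1 := Complex.I_sq
  simp only [fderiv_split, map_smul, dz_uu', Complex.real_smul] at hAe hBe
  set t := dz (deriv γ s)
  set tb := dzb (deriv γ s)
  constructor
  · refine TP_divide (n := n) (hC.1.continuousOn.comp_continuous hcu (hA s)) ht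
      (R := Polynomial.C t * A + Polynomial.C (-Complex.I / r) * (Polynomial.X * B)) ?_ ?_
    · exact (Polynomial.degree_add_le _ _).trans_lt
        (max_lt (degree_C_mul_lt_aux hAd _) (degree_X_mul_lt_aux hBd _))
    · intro φ
      have h1 := hAe φ
      have h2 := hBe φ
      have h3 := dzb_uu' φ
      simp only [Polynomial.eval_add, Polynomial.eval_mul, Polynomial.eval_C, Polynomial.eval_X]
      generalize Dz H (γ s + r • uu φ) = a at *
      generalize Dzb H (γ s + r • uu φ) = b at *
      have h4 : (ww φ ^ 2 + t ^ 2) * a = t * (a * t + b * tb) + (-Complex.I / r) * ww φ *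
          (r * (a * (Complex.I * ww φ) + b * dzb (uu' φ))) := by
        field_simp
        linear_combination (ww φ ^ 2 * a - b) * hI - b * htb + Complex.I * b * h3
      rw [h4, h1, h2]; ring
  · refine TP_divide (n := n) (hC.2.continuousOn.comp_continuous hcu (hA s)) ht
      (R := Polynomial.C t * (Polynomial.X * A) + Polynomial.C (Complex.I / r * t ^ 2) * B) ?_ ?_
    · exact (Polynomial.degree_add_le _ _).trans_lt
        (max_lt (degree_X_mul_lt_aux hAd _) (degree_C_mul_lt_aux hBd _))
    · intro φ
      have h1 := hAe φ
      have h2 := hBe φ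
      have h3 := dzb_uu' φ
      simp only [Polynomial.eval_add, Polynomial.eval_mul, Polynomial.eval_C, Polynomial.eval_X]
      generalize Dz H (γ s + r • uu φ) = a at *
      generalize Dzb H (γ s + r • uu φ) = b at *
      have h4 : (ww φ ^ 2 + t ^ 2) * b = ww φ ^ 2 * t * (a * t + b * tb)
          + (Complex.I / r * t ^ 2) * ww φ *
          (r * (a * (Complex.I * ww φ) + b * dzb (uu' φ))) := by
        field_simp
        linear_combination (-(ww φ ^ 2 * t ^ 2 * a) + t ^ 2 * b) * hI - ww φ ^ 2 * b * htb
          - Complex.I * t ^ 2 * b * h3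
      rw [h4, h1, h2, zpow_add_one₀ (ww_ne φ)]; ring

theorem iter_zero {r : ℝ} (hr : 0 < r) {γ : ℝ → EuclideanSpace ℝ (Fin 2)}
    (hγ : Differentiable ℝ γ) (hunit : ∀ s, ‖deriv γ s‖ = 1)
    {U : Set (EuclideanSpace ℝ (Fin 2))} (hU : IsOpen U)
    (hA : ∀ s φ, γ s + r • uu φ ∈ U) :
    ∀ (n : ℕ) (p : ℤ) (H : EuclideanSpace ℝ (Fin 2) → ℂ), ContDiffOn ℝ (⊤ : ℕ∞) H U →
      (∀ s, (fun φ => H (γ s + r • uu φ)) ∈ TP p n) →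
      ∀ s φ, iteratedFDeriv ℝ n H (γ s + r • uu φ) = 0 := by
  intro n
  induction n with
  | zero =>
    intro p H hH hT s φ
    obtain ⟨Q, hQ, hQe⟩ := mem_TP.1 (hT s)
    have hQ0 : Q = 0 := by
      by_contra h
      rw [Polynomial.degree_eq_natDegree h] at hQ
      norm_cast at hQ
    ext m
    rw [iteratedFDeriv_zero_apply]
    have := hQe φ
    simp only [hQ0, Polynomial.eval_zero, mul_zero] at this
    simpa using this
  | succ n ih =>
    intro p H hH hT s φ
    have hst := class_step hr hγ hunit hU hA hH hT
    have hC := contDiffOn_Dz hU hH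
    have i1 := ih p (Dz H) hC.1 (fun s => (hst s).1) s φ
    have i2 := ih (p + 1) (Dzb H) hC.2 (fun s => (hst s).2) s φ
    set x := γ s + r • uu φ with hx
    have hxU : x ∈ U := hA s φ
    let L1 : ℂ →L[ℝ] (EuclideanSpace ℝ (Fin 2) →L[ℝ] ℂ) :=
      (ContinuousLinearMap.toSpanSingleton ℂ dz).restrictScalars ℝ
    let L2 : ℂ →L[ℝ] (EuclideanSpace ℝ (Fin 2) →L[ℝ] ℂ) :=
      (ContinuousLinearMap.toSpanSingleton ℂ dzb).restrictScalars ℝ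
    have hfd : (fun y => fderiv ℝ H y) = (L1 ∘ Dz H) + (L2 ∘ Dzb H) := by
      funext y
      refine ContinuousLinearMap.ext fun v => ?_
      rw [fderiv_split]
      simp [L1, L2]
    have hn : ((n : ℕ) : WithTop ℕ∞) ≤ ((⊤ : ℕ∞) : WithTop ℕ∞) :=
      WithTop.coe_le_coe.2 (le_top : (n : ℕ∞) ≤ ⊤)
    have c1 : ContDiffAt ℝ n (Dz H) x := (hC.1.contDiffAt (hU.mem_nhds hxU)).of_le hn
    have c2 : ContDiffAt ℝ n (Dzb H) x := (hC.2.contDiffAt (hU.mem_nhds hxU)).of_le hn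
    have hz : iteratedFDeriv ℝ n (fun y => fderiv ℝ H y) x = 0 := by
      rw [hfd, iteratedFDeriv_add_apply (L1.contDiff.contDiffAt.comp x c1)
        (L2.contDiff.contDiffAt.comp x c2),
        L1.iteratedFDeriv_comp_left c1 le_rfl, L2.iteratedFDeriv_comp_left c2 le_rfl, i1, i2]
      ext m
      simp
    ext m
    rw [iteratedFDeriv_succ_apply_right]
    have hz2 : iteratedFDeriv ℝ n (fderiv ℝ H) x = 0 := hz
    rw [hz2]
    simp

theorem poly_TP (r : ℝ) (c : EuclideanSpace ℝ (Fin 2)) (N : ℕ) (p : MvPolynomial (Fin 2) ℝ)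
    (hp : p.totalDegree ≤ N) :
    (fun φ : ℝ => ((MvPolynomial.eval (fun i => (c + r • uu φ) i) p : ℝ) : ℂ))
      ∈ TP (-(N : ℤ)) (2 * N + 1) := by
  let q0 : Polynomial ℂ := Polynomial.C (r / 2 : ℂ) * Polynomial.X ^ 2
    + Polynomial.C (c 0 : ℂ) * Polynomial.X + Polynomial.C (r / 2 : ℂ)
  let q1 : Polynomial ℂ := Polynomial.C (-Complex.I * r / 2 : ℂ) * Polynomial.X ^ 2
    + Polynomial.C (c 1 : ℂ) * Polynomial.X + Polynomial.C (Complex.I * r / 2 : ℂ)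
  have hq0 : q0.natDegree ≤ 2 := Polynomial.natDegree_quadratic_le
  have hq1 : q1.natDegree ≤ 2 := Polynomial.natDegree_quadratic_le
  have hI : Complex.I ^ 2 = -1 := Complex.I_sq
  have e0 : ∀ φ, q0.eval (ww φ) = ww φ * ((c + r • uu φ) 0 : ℝ) := by
    intro φ
    have h1 := Complex.sin_sq_add_cos_sq (φ : ℂ)
    simp [q0, uu, ww, Complex.exp_mul_I]
    linear_combination (-(r : ℂ) / 2) * h1 + (r : ℂ) / 2 * Complex.sin φ ^ 2 * hI
  have e1 : ∀ φ, q1.eval (ww φ) = ww φ * ((c + r • uu φ) 1 : ℝ) := by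
    intro φ
    have h1 := Complex.sin_sq_add_cos_sq (φ : ℂ)
    simp [q1, uu, ww, Complex.exp_mul_I]
    linear_combination (-(r : ℂ) * Complex.I / 2) * h1 + (-(r : ℂ) * Complex.sin φ * Complex.cos φ
      - (r : ℂ) / 2 * Complex.I * Complex.sin φ ^ 2) * hI
  have hsup : ∀ d ∈ p.support, d 0 + d 1 ≤ N := by
    intro d hd
    have := (MvPolynomial.le_totalDegree hd).trans hp
    rwa [Finsupp.sum_fintype _ _ (fun _ => rfl), Fin.sum_univ_two] at this
  refine mem_TP.2 ⟨∑ d ∈ p.support, Polynomial.C ((p.coeff d : ℝ) : ℂ) *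
    (Polynomial.X ^ (N - (d 0 + d 1)) * (q0 ^ d 0 * q1 ^ d 1)), ?_, fun φ => ?_⟩
  · rw [← Polynomial.mem_degreeLT]
    refine Submodule.sum_mem _ fun d hd => ?_
    rw [Polynomial.mem_degreeLT]
    refine (degree_C_mul_le_aux _ _).trans_lt ?_
    refine lt_of_le_of_lt (Polynomial.degree_le_of_natDegree_le (n := 2 * N) ?_)
      (by norm_cast; omega)
    have := hsup d hd
    refine Polynomial.natDegree_mul_le.trans ?_
    have a1 : (q0 ^ d 0 * q1 ^ d 1).natDegree ≤ d 0 * 2 + d 1 * 2 :=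
      Polynomial.natDegree_mul_le.trans (add_le_add (Polynomial.natDegree_pow_le_of_le _ hq0)
        (Polynomial.natDegree_pow_le_of_le _ hq1))
    rw [Polynomial.natDegree_X_pow]
    omega
  · rw [MvPolynomial.eval_eq', Polynomial.eval_finsetSum, Finset.mul_sum, Complex.ofReal_sum]
    refine Finset.sum_congr rfl fun d hd => ?_
    have hN := hsup d hd
    simp only [Polynomial.eval_mul, Polynomial.eval_C, Polynomial.eval_pow, Polynomial.eval_X, e0,
      e1, Fin.prod_univ_two, Complex.ofReal_mul, Complex.ofReal_pow]
    generalize (((c + r • uu φ) 0 : ℝ) : ℂ) = a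
    generalize (((c + r • uu φ) 1 : ℝ) : ℂ) = b
    have h3 : ww φ ^ (-(N : ℤ)) * (ww φ ^ (N - (d 0 + d 1)) * (ww φ ^ d 0 * ww φ ^ d 1)) = 1 := by
      rw [← pow_add, ← pow_add, Nat.sub_add_cancel hN, zpow_neg, zpow_natCast,
        inv_mul_cancel₀ (pow_ne_zero _ (ww_ne φ))]
    rw [mul_pow, mul_pow]
    linear_combination (-((p.coeff d : ℝ) : ℂ) * a ^ d 0 * b ^ d 1) * h3

/-- If a C^∞ function F on an open set containing the union A of all circles
`C_s = {x : |x − γ(s)| = r}` restricts on each circle C_s to a polynomial of total degree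
at most N, then F coincides on A with a single polynomial of total degree at most 2N. -/
theorem polynomial_on_circles_global
    (r : ℝ) (hr : 0 < r) (γ : ℝ → EuclideanSpace ℝ (Fin 2))
    (hγ : ContDiff ℝ (⊤ : ℕ∞) γ) (hunit : ∀ s, ‖deriv γ s‖ = 1)
    (N : ℕ) (U : Set (EuclideanSpace ℝ (Fin 2))) (hU : IsOpen U)
    (hAU : (⋃ s : ℝ, Metric.sphere (γ s) r) ⊆ U)
    (F : EuclideanSpace ℝ (Fin 2) → ℝ) (hF : ContDiffOn ℝ (⊤ : ℕ∞) F U)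
    (hpoly : ∀ s : ℝ, ∃ p : MvPolynomial (Fin 2) ℝ, p.totalDegree ≤ N ∧
      ∀ x ∈ Metric.sphere (γ s) r, F x = MvPolynomial.eval (fun i => x i) p) :
    ∃ P : MvPolynomial (Fin 2) ℝ, P.totalDegree ≤ 2 * N ∧
      ∀ x ∈ ⋃ s : ℝ, Metric.sphere (γ s) r,
        F x = MvPolynomial.eval (fun i => x i) P := by
  have hγd : Differentiable ℝ γ := hγ.differentiable (by simp)
  have hA : ∀ s φ, γ s + r • uu φ ∈ U := fun s φ =>
    hAU (Set.mem_iUnion.2 ⟨s, mem_sphere_pt hr φ⟩)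
  have hz : ∀ s φ, iteratedFDeriv ℝ (2 * N + 1) F (γ s + r • uu φ) = 0 := by
    intro s φ
    have h1 := iter_zero hr hγd hunit hU hA (2 * N + 1) (-(N : ℤ)) (Complex.ofRealCLM ∘ F)
      (Complex.ofRealCLM.contDiff.comp_contDiffOn hF) (fun s => by
        obtain ⟨p, hp, hpe⟩ := hpoly s
        have := poly_TP r (γ s) N p hp
        convert this using 2 with φ
        simp only [Function.comp, Complex.ofRealCLM_apply]
        rw [hpe _ (mem_sphere_pt hr φ)]) s φ
    rw [Complex.ofRealCLM.iteratedFDeriv_comp_left (hF.contDiffAt (hU.mem_nhds (hA s φ)))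
      (WithTop.coe_le_coe.2 (le_top : ((2 * N + 1 : ℕ) : ℕ∞) ≤ ⊤))] at h1
    ext m
    have h2 := DFunLike.congr_fun h1 m
    simpa using h2
  obtain ⟨P, hP, hPe⟩ := integrate r γ hγd hU hA (2 * N) F hF hz
  refine ⟨P, hP, fun x hx => ?_⟩
  obtain ⟨s, hs⟩ := Set.mem_iUnion.1 hx
  obtain ⟨φ, rfl⟩ := exists_pt hr hs
  exact hPe s φ
end

section
/- Let r > 0, 0 < ε < 2r, N ∈ ℕ, let γ : ℝ → ℝ² be a smooth unit-speed plane curve, fix s₀ ∈ ℝ, and set A_{s₀,ε} := ⋃_{|s−s₀| ≤ ε} C_s where C_s := {x ∈ ℝ² : |x − γ(s)| = r}. Let F be a C^∞ function on an open neighborhood of A_{s₀,ε}, and suppose that for every s with |s − s₀| < ε the restriction of F to C_s coincides with the restriction to C_s of some real polynomial in two variables of total degree at most N. Then F coincides on A_{s₀,ε} with a real polynomial in the two variables x₁, x₂ of total degree at most 2N. -/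
open Real

namespace PC

noncomputable def dz (f : ℂ → ℂ) (z : ℂ) : ℂ :=
  (fderiv ℝ f z 1 - Complex.I * fderiv ℝ f z Complex.I) / 2

noncomputable def db (f : ℂ → ℂ) (z : ℂ) : ℂ :=
  (fderiv ℝ f z 1 + Complex.I * fderiv ℝ f z Complex.I) / 2

lemma fderiv_eq (f : ℂ → ℂ) (z v : ℂ) :
    fderiv ℝ f z v = v * dz f z + (starRingEnd ℂ v) * db f z := by
  have h : v = v.re • (1 : ℂ) + v.im • Complex.I := by
    simp [Complex.re_add_im]
  have h2 : fderiv ℝ f z v = v.re * fderiv ℝ f z 1 + v.im * fderiv ℝ f z Complex.I := by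
    conv_lhs => rw [h]
    rw [map_add, map_smul, map_smul]; simp
  have h3 : (starRingEnd ℂ v) = v.re - v.im * Complex.I := by
    apply Complex.ext <;> simp
  have h4 : v = v.re + v.im * Complex.I := (Complex.re_add_im v).symm
  rw [h2, h3]
  conv_rhs => enter [1]; rw [h4]
  unfold dz db
  ring_nf
  simp only [Complex.I_sq]
  ring

lemma dz_smooth {f : ℂ → ℂ} {U : Set ℂ} (hU : IsOpen U) (hf : ContDiffOn ℝ (⊤ : ℕ∞) f U) :
    ContDiffOn ℝ (⊤ : ℕ∞) (dz f) U := by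
  have h := hf.fderiv_of_isOpen (m := (⊤ : ℕ∞)) hU (by simp)
  unfold dz
  exact ((h.clm_apply contDiffOn_const).sub
    (contDiffOn_const.mul (h.clm_apply contDiffOn_const))).div_const _

lemma db_smooth {f : ℂ → ℂ} {U : Set ℂ} (hU : IsOpen U) (hf : ContDiffOn ℝ (⊤ : ℕ∞) f U) :
    ContDiffOn ℝ (⊤ : ℕ∞) (db f) U := by
  have h := hf.fderiv_of_isOpen (m := (⊤ : ℕ∞)) hU (by simp)
  unfold db
  exact ((h.clm_apply contDiffOn_const).add
    (contDiffOn_const.mul (h.clm_apply contDiffOn_const))).div_const _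

lemma dz_congr {f g : ℂ → ℂ} {U : Set ℂ} (hU : IsOpen U) (h : Set.EqOn f g U) :
    Set.EqOn (dz f) (dz g) U := by
  intro z hz
  have : fderiv ℝ f z = fderiv ℝ g z :=
    Filter.EventuallyEq.fderiv_eq (Filter.eventuallyEq_of_mem (hU.mem_nhds hz) h)
  simp [dz, this]

lemma db_congr {f g : ℂ → ℂ} {U : Set ℂ} (hU : IsOpen U) (h : Set.EqOn f g U) :
    Set.EqOn (db f) (db g) U := by
  intro z hz
  have : fderiv ℝ f z = fderiv ℝ g z :=
    Filter.EventuallyEq.fderiv_eq (Filter.eventuallyEq_of_mem (hU.mem_nhds hz) h)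
  simp [db, this]

lemma hasd {f : ℂ → ℂ} {U : Set ℂ} (hU : IsOpen U) (hf : ContDiffOn ℝ (⊤ : ℕ∞) f U)
    {z : ℂ} (hz : z ∈ U) : HasFDerivAt f (fderiv ℝ f z) z :=
  ((hf.contDiffAt (hU.mem_nhds hz)).differentiableAt (by simp)).hasFDerivAt

/-- commutation -/
lemma dz_db_comm {f : ℂ → ℂ} {U : Set ℂ} (hU : IsOpen U) (hf : ContDiffOn ℝ (⊤ : ℕ∞) f U)
    {z : ℂ} (hz : z ∈ U) : dz (db f) z = db (dz f) z := by
  have hc := hf.contDiffAt (hU.mem_nhds hz)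
  have hs : IsSymmSndFDerivAt ℝ f z := hc.isSymmSndFDerivAt (by simp only [minSmoothness_of_isRCLikeNormedField]; exact WithTop.coe_le_coe.mpr le_top)
  have h1 : HasFDerivAt (fderiv ℝ f) (fderiv ℝ (fderiv ℝ f) z) z := by
    have h := hf.fderiv_of_isOpen (m := (⊤ : ℕ∞)) hU (by simp)
    exact ((h.contDiffAt (hU.mem_nhds hz)).differentiableAt (by simp)).hasFDerivAt
  set B := fderiv ℝ (fderiv ℝ f) z
  have ha (v : ℂ) : HasFDerivAt (fun y => fderiv ℝ f y v) (B.flip v) z := by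
    simpa using h1.clm_apply (hasFDerivAt_const v z)
  have hdz : HasFDerivAt (dz f) ((2:ℂ)⁻¹ • (B.flip 1 - Complex.I • B.flip Complex.I)) z := by
    have := ((ha 1).sub ((ha Complex.I).const_mul Complex.I)).const_mul ((2:ℂ)⁻¹)
    refine this.congr_of_eventuallyEq (Filter.Eventually.of_forall fun y => ?_)
    simp [dz]; ring
  have hdb : HasFDerivAt (db f) ((2:ℂ)⁻¹ • (B.flip 1 + Complex.I • B.flip Complex.I)) z := by
    have := ((ha 1).add ((ha Complex.I).const_mul Complex.I)).const_mul ((2:ℂ)⁻¹)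
    refine this.congr_of_eventuallyEq (Filter.Eventually.of_forall fun y => ?_)
    simp [db]; ring
  have hsym : B Complex.I 1 = B 1 Complex.I := hs _ _
  rw [dz, db, hdz.fderiv, hdb.fderiv]
  simp [hsym]
  ring

/-- weighted Euler operator -/
noncomputable def eu (c : ℂ) (f : ℂ → ℂ) (z : ℂ) : ℂ :=
  c * f z - z * dz f z - (starRingEnd ℂ z) * db f z

lemma eu_smooth (c : ℂ) {f : ℂ → ℂ} {U : Set ℂ} (hU : IsOpen U)
    (hf : ContDiffOn ℝ (⊤ : ℕ∞) f U) : ContDiffOn ℝ (⊤ : ℕ∞) (eu c f) U := by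
  unfold eu
  exact ((contDiffOn_const.mul hf).sub (contDiffOn_id.mul (dz_smooth hU hf))).sub
    ((Complex.conjCLE.contDiff.contDiffOn).mul (db_smooth hU hf))

lemma eu_fderiv (c : ℂ) {f : ℂ → ℂ} {U : Set ℂ} (hU : IsOpen U)
    (hf : ContDiffOn ℝ (⊤ : ℕ∞) f U) {z : ℂ} (hz : z ∈ U) (v : ℂ) :
    fderiv ℝ (eu c f) z v = c * fderiv ℝ f z v - (z * fderiv ℝ (dz f) z v + v * dz f z)
      - ((starRingEnd ℂ z) * fderiv ℝ (db f) z v + (starRingEnd ℂ v) * db f z) := by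
  have h := (((hasd hU hf hz).const_mul c).sub
    ((hasFDerivAt_id z).mul (hasd hU (dz_smooth hU hf) hz))).sub
    ((Complex.conjCLE.hasFDerivAt (x := z)).mul (hasd hU (db_smooth hU hf) hz))
  have h' : HasFDerivAt (eu c f) _ z := h
  rw [h'.fderiv]
  simp
  ring

lemma dz_eu (c : ℂ) {f : ℂ → ℂ} {U : Set ℂ} (hU : IsOpen U)
    (hf : ContDiffOn ℝ (⊤ : ℕ∞) f U) : Set.EqOn (dz (eu (c + 1) f)) (eu c (dz f)) U := by
  intro z hz
  have hc := dz_db_comm hU hf hz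
  rw [dz, eu_fderiv _ hU hf hz, eu_fderiv _ hU hf hz, eu, ← hc]
  simp only [fderiv_eq, map_one, Complex.conj_I]
  ring_nf
  simp only [Complex.I_sq]
  ring_nf

lemma db_eu (c : ℂ) {f : ℂ → ℂ} {U : Set ℂ} (hU : IsOpen U)
    (hf : ContDiffOn ℝ (⊤ : ℕ∞) f U) : Set.EqOn (db (eu (c + 1) f)) (eu c (db f)) U := by
  intro z hz
  have hc := dz_db_comm hU hf hz
  rw [db, eu_fderiv _ hU hf hz, eu_fderiv _ hU hf hz, eu, hc]
  simp only [fderiv_eq, map_one, Complex.conj_I]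
  ring_nf
  simp only [Complex.I_sq]
  ring_nf

def K (A : Set ℂ) : ℕ → (ℂ → ℂ) → Prop
  | 0, f => ∀ z ∈ A, f z = 0
  | m + 1, f => K A m (dz f) ∧ K A m (db f)

lemma K_congr {U A : Set ℂ} (hU : IsOpen U) (hA : A ⊆ U) (m : ℕ) :
    ∀ {f g : ℂ → ℂ}, Set.EqOn f g U → K A m g → K A m f := by
  induction m with
  | zero => intro f g h hg z hz; rw [h (hA hz)]; exact hg z hz
  | succ m ih => intro f g h hg; exact ⟨ih (dz_congr hU h) hg.1, ih (db_congr hU h) hg.2⟩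

lemma K_eu {U A : Set ℂ} (hU : IsOpen U) (hA : A ⊆ U) (m : ℕ) :
    ∀ {f : ℂ → ℂ}, ContDiffOn ℝ (⊤ : ℕ∞) f U → K A (m + 1) f → K A m (eu m f) := by
  induction m with
  | zero =>
    intro f _ h z hz
    simp [eu, h.1 z hz, h.2 z hz]
  | succ m ih =>
    intro f hf h
    push_cast
    exact ⟨K_congr hU hA m (dz_eu m hU hf) (ih (dz_smooth hU hf) h.1),
      K_congr hU hA m (db_eu m hU hf) (ih (db_smooth hU hf) h.2)⟩

noncomputable def ev (P : MvPolynomial (Fin 2) ℝ) (z : ℂ) : ℝ :=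
  MvPolynomial.eval ![z.re, z.im] P

def PolyOn (A : Set ℂ) (m : ℕ) (f : ℂ → ℂ) : Prop :=
  ∃ P Q : MvPolynomial (Fin 2) ℝ, P.totalDegree ≤ m ∧ Q.totalDegree ≤ m ∧
    ∀ z ∈ A, f z = ev P z + ev Q z * Complex.I

open MvPolynomial in
lemma K_poly {U A : Set ℂ} (hU : IsOpen U) (hA : A ⊆ U)
    (hconst : ∀ f : ℂ → ℂ, ContDiffOn ℝ (⊤ : ℕ∞) f U → K A 1 f → ∃ c, ∀ z ∈ A, f z = c) (m : ℕ) :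
    ∀ {f : ℂ → ℂ}, ContDiffOn ℝ (⊤ : ℕ∞) f U → K A (m + 1) f → PolyOn A m f := by
  induction m with
  | zero =>
    intro f hf h
    obtain ⟨c, hc⟩ := hconst f hf h
    refine ⟨C c.re, C c.im, by simp, by simp, fun z hz => ?_⟩
    simp [ev, hc z hz]
  | succ m ih =>
    intro f hf h
    obtain ⟨P1, Q1, hP1, hQ1, h1⟩ := ih (dz_smooth hU hf) h.1
    obtain ⟨P2, Q2, hP2, hQ2, h2⟩ := ih (db_smooth hU hf) h.2
    obtain ⟨P3, Q3, hP3, hQ3, h3⟩ := ih (eu_smooth _ hU hf) (K_eu hU hA (m + 1) hf h)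
    have key : ∀ P : MvPolynomial (Fin 2) ℝ, ∀ i, P.totalDegree ≤ m →
        (X i * P).totalDegree ≤ m + 1 := by
      intro P i hP
      refine (totalDegree_mul _ _).trans ?_
      rw [totalDegree_X]; omega
    have ka : ∀ P Q : MvPolynomial (Fin 2) ℝ, P.totalDegree ≤ m + 1 → Q.totalDegree ≤ m + 1 →
        (P + Q).totalDegree ≤ m + 1 := fun P Q hP hQ => (totalDegree_add _ _).trans (max_le hP hQ)
    have ks : ∀ P Q : MvPolynomial (Fin 2) ℝ, P.totalDegree ≤ m + 1 → Q.totalDegree ≤ m + 1 →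
        (P - Q).totalDegree ≤ m + 1 := fun P Q hP hQ => (totalDegree_sub _ _).trans (max_le hP hQ)
    have kc : ∀ (c : ℝ) (P : MvPolynomial (Fin 2) ℝ), P.totalDegree ≤ m + 1 →
        (C c * P).totalDegree ≤ m + 1 := by
      intro c P hP
      refine (totalDegree_mul _ _).trans ?_
      rw [totalDegree_C]; omega
    refine ⟨C ((m + 1 : ℝ)⁻¹) * (P3 + (X 0 * P1 - X 1 * Q1) + (X 0 * P2 + X 1 * Q2)),
      C ((m + 1 : ℝ)⁻¹) * (Q3 + (X 0 * Q1 + X 1 * P1) + (X 0 * Q2 - X 1 * P2)), ?_, ?_, ?_⟩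
    · exact kc _ _ (ka _ _ (ka _ _ (by omega) (ks _ _ (key _ _ hP1) (key _ _ hQ1)))
        (ka _ _ (key _ _ hP2) (key _ _ hQ2)))
    · exact kc _ _ (ka _ _ (ka _ _ (by omega) (ka _ _ (key _ _ hQ1) (key _ _ hP1)))
        (ks _ _ (key _ _ hQ2) (key _ _ hP2)))
    · intro z hz
      have e3 := h3 z hz
      rw [eu, h1 z hz, h2 z hz] at e3
      have hm : ((m : ℂ) + 1) ≠ 0 := by exact_mod_cast Nat.succ_ne_zero m
      have hz1 : (starRingEnd ℂ z) = z.re - z.im * Complex.I := by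
        apply Complex.ext <;> simp
      have hz2 : z = z.re + z.im * Complex.I := (Complex.re_add_im z).symm
      have e4 : ((m : ℂ) + 1) * f z = ev P3 z + ev Q3 z * Complex.I
          + (z.re + z.im * Complex.I) * (ev P1 z + ev Q1 z * Complex.I)
          + (z.re - z.im * Complex.I) * (ev P2 z + ev Q2 z * Complex.I) := by
        rw [← hz1, ← hz2, ← e3]; push_cast; ring
      apply mul_left_cancel₀ hm
      rw [e4]
      simp only [ev, map_mul, map_add, map_sub, eval_C, eval_X]
      push_cast
      field_simp
      ring_nf
      simp only [Complex.I_sq]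
      ring

open Polynomial Filter Topology

def Spec (I : Set ℝ) (g : ℝ → ℂ) (r : ℝ) (a : ℤ) (m : ℕ) (f : ℂ → ℂ) : Prop :=
  ∀ s ∈ I, ∃ Q ∈ degreeLT ℂ m, ∀ w : Circle, f (g s + r * w) = (w : ℂ) ^ a * Q.eval (w : ℂ)

/-- evaluation map -/
noncomputable def Lm (a : ℤ) : ℂ[X] →ₗ[ℂ] (Circle → ℂ) where
  toFun Q w := (w : ℂ) ^ a * Q.eval (w : ℂ)
  map_add' P Q := by ext w; simp [mul_add]
  map_smul' c Q := by ext w; simp; ring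

lemma deriv_spec {I : Set ℝ} (hI : IsOpen I) {g : ℝ → ℂ} {r : ℝ} {a : ℤ} {m : ℕ} {f : ℂ → ℂ}
    (h : Spec I g r a m f) {s : ℝ} (hs : s ∈ I) {D : Circle → ℂ}
    (hD : ∀ w : Circle, HasDerivAt (fun t : ℝ => f (g t + r * w)) (D w) s) :
    ∃ Q ∈ degreeLT ℂ m, ∀ w : Circle, D w = (w : ℂ) ^ a * Q.eval (w : ℂ) := by
  let V : Submodule ℂ (Circle → ℂ) := (degreeLT ℂ m).map (Lm a)
  have : FiniteDimensional ℂ (degreeLT ℂ m) :=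
    Module.Finite.equiv (degreeLTEquiv ℂ m).symm
  have hV : FiniteDimensional ℂ V := inferInstance
  have hcl : IsClosed (V : Set (Circle → ℂ)) := V.closed_of_finiteDimensional
  have hmem : ∀ t ∈ I, (fun w : Circle => f (g t + r * w)) ∈ V := by
    intro t ht
    obtain ⟨Q, hQ, hq⟩ := h t ht
    exact ⟨Q, hQ, by ext w; exact (hq w).symm⟩
  have ht : Tendsto (fun t : ℝ => fun w : Circle => slope (fun t : ℝ => f (g t + r * w)) s t)
      (𝓝[≠] s) (𝓝 D) := by
    rw [tendsto_pi_nhds]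
    intro w
    exact (hasDerivAt_iff_tendsto_slope.mp (hD w))
  have hDV : D ∈ (V : Set (Circle → ℂ)) := by
    refine hcl.mem_of_tendsto ht ?_
    filter_upwards [mem_nhdsWithin_of_mem_nhds (hI.mem_nhds hs)] with t htI
    have := V.smul_mem (((t - s)⁻¹ : ℝ) : ℂ) (V.sub_mem (hmem t htI) (hmem s hs))
    have e : (fun w : Circle => slope (fun t : ℝ => f (g t + r * w)) s t) =
        (((t - s)⁻¹ : ℝ) : ℂ) • ((fun w : Circle => f (g t + r * w)) - fun w : Circle => f (g s + r * w)) := by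
      ext w
      simp [slope]
    rw [e]
    exact this
  obtain ⟨Q, hQ, hq⟩ := hDV
  exact ⟨Q, hQ, fun w => by rw [← hq]; rfl⟩

/-- density on the circle -/
lemma circle_ext {h k : Circle → ℂ} (hh : Continuous h) (hk : Continuous k) (c : ℂ)
    (he : ∀ w : Circle, (w : ℂ) ^ 2 ≠ c → h w = k w) : h = k := by
  ext w
  by_cases hw : (w : ℂ) ^ 2 = c
  swap
  · exact he w hw
  let q : ℝ → Circle := fun t => w * Circle.exp t
  have hq : Continuous q := by fun_prop
  have hq0 : q 0 = w := by simp [q]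
  have hder : HasDerivAt (fun t : ℝ => ((q t : Circle) : ℂ) ^ 2) (2 * Complex.I * w ^ 2) 0 := by
    have h1 : HasDerivAt (fun t : ℝ => Complex.exp (t * Complex.I)) (Complex.I) 0 := by
      have := ((Complex.ofRealCLM.hasDerivAt (x := (0:ℝ))).mul_const Complex.I).cexp
      simpa using this
    have h2 := (h1.const_mul (w : ℂ)).pow 2
    simp only [q, Circle.coe_mul, Circle.coe_exp]
    refine h2.congr_deriv ?_
    simp; ring
  have hne : ∀ᶠ t in 𝓝[≠] (0:ℝ), ((q t : Circle) : ℂ) ^ 2 ≠ c := by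
    exact hder.eventually_ne (by simp)
  have t1 : Tendsto (fun t => h (q t)) (𝓝[≠] (0:ℝ)) (𝓝 (h w)) := by
    have := (hh.comp hq).tendsto 0
    simp only [Function.comp, hq0] at this
    exact this.mono_left nhdsWithin_le_nhds
  have t2 : Tendsto (fun t => k (q t)) (𝓝[≠] (0:ℝ)) (𝓝 (k w)) := by
    have := (hk.comp hq).tendsto 0
    simp only [Function.comp, hq0] at this
    exact this.mono_left nhdsWithin_le_nhds
  refine tendsto_nhds_unique t1 (t2.congr' ?_)
  filter_upwards [hne] with t ht
  exact (he _ ht).symm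

/-- division step -/
lemma div_step {h : Circle → ℂ} (hh : Continuous h) {a : ℤ} {m : ℕ} (u : Circle) {R : ℂ[X]}
    (hR : R ∈ degreeLT ℂ (m + 2))
    (he : ∀ w : Circle, (w : ℂ) ^ a * R.eval (w : ℂ) = h w * ((w : ℂ) ^ 2 + (u : ℂ) ^ 2)) :
    ∃ S ∈ degreeLT ℂ m, ∀ w : Circle, h w = (w : ℂ) ^ a * S.eval (w : ℂ) := by
  have hu : (u : ℂ) ≠ 0 := u.coe_ne_zero
  let i1 : Circle := ⟨Complex.I, by simp [Submonoid.unitSphere]⟩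
  have hi1 : (i1 : ℂ) = Complex.I := rfl
  have hr1 : R.eval (Complex.I * u) = 0 := by
    have := he (i1 * u)
    simp only [Circle.coe_mul, hi1, mul_pow, Complex.I_sq] at this
    have h0 : (Complex.I * (u : ℂ)) ^ a ≠ 0 := zpow_ne_zero _ (by simp [hu])
    simpa [hu, h0] using this
  have hr2 : R.eval (- (Complex.I * u)) = 0 := by
    have := he (i1⁻¹ * u)
    simp only [Circle.coe_mul, Circle.coe_inv, hi1, mul_pow, Complex.I_sq, Complex.inv_I] at this
    have h0 : (-(Complex.I * (u : ℂ))) ^ a ≠ 0 := zpow_ne_zero _ (by simp [hu])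
    simpa [hu, h0] using this
  have hd : (X ^ 2 + C ((u : ℂ) ^ 2)) ∣ R := by
    have e : (X ^ 2 + C ((u : ℂ) ^ 2) : ℂ[X])
        = (X - C (Complex.I * u)) * (X - C (-(Complex.I * u))) := by
      have : C ((u:ℂ)^2) = - C (Complex.I * u) * C (Complex.I * u) := by
        rw [← C_neg, ← C_mul]; congr 1; ring_nf; simp
      rw [this, C_neg]; ring
    rw [e]
    refine IsCoprime.mul_dvd ?_ (dvd_iff_isRoot.mpr hr1) (dvd_iff_isRoot.mpr hr2)
    apply isCoprime_X_sub_C_of_isUnit_sub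
    rw [isUnit_iff_ne_zero]
    ring_nf
    simp [hu]
  obtain ⟨S, hS⟩ := hd
  refine ⟨S, ?_, ?_⟩
  · rw [mem_degreeLT] at hR ⊢
    rw [hS, degree_mul, degree_X_pow_add_C (by norm_num)] at hR
    by_cases hS0 : S = 0
    · simp [hS0]
    rw [degree_eq_natDegree hS0] at hR ⊢
    norm_cast at hR ⊢
    omega
  · have hcont : Continuous fun w : Circle => (w : ℂ) ^ a * S.eval (w : ℂ) := by
      have hcc : Continuous fun w : Circle => (w : ℂ) := by fun_prop
      refine Continuous.mul ?_ (S.continuous.comp hcc)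
      exact hcc.zpow₀ a (fun w => Or.inl w.coe_ne_zero)
    have := circle_ext hh hcont (-(u : ℂ) ^ 2) (fun w hw => by
      have h0 : (w : ℂ) ^ 2 + (u : ℂ) ^ 2 ≠ 0 := fun h => hw (eq_neg_of_add_eq_zero_left h)
      have := he w
      rw [hS] at this
      simp only [eval_mul, eval_add, eval_pow, eval_X, eval_C] at this
      apply mul_right_cancel₀ h0
      rw [← this]; ring)
    intro w; exact congrFun this w

lemma phi_deriv (Q : ℂ[X]) (a : ℤ) (w : Circle) :
    HasDerivAt (fun t : ℝ => ((w * Circle.exp t : Circle) : ℂ) ^ a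
      * Q.eval ((w * Circle.exp t : Circle) : ℂ))
      ((w : ℂ) ^ a * (Complex.I * (a * Q.eval (w : ℂ) + w * Q.derivative.eval (w : ℂ)))) 0 := by
  have h1 : HasDerivAt (fun t : ℝ => ((w * Circle.exp t : Circle) : ℂ)) (w * Complex.I) 0 := by
    have := ((Complex.ofRealCLM.hasDerivAt (x := (0:ℝ))).mul_const Complex.I).cexp
    simpa using this.const_mul (w : ℂ)
  have hw : (w : ℂ) ≠ 0 := w.coe_ne_zero
  have h2 : HasDerivAt (fun z : ℂ => z ^ a * Q.eval z)
      ((a * (w : ℂ) ^ (a - 1)) * Q.eval (w : ℂ) + (w : ℂ) ^ a * Q.derivative.eval (w : ℂ)) (w : ℂ) :=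
    (hasDerivAt_zpow a _ (Or.inl hw)).mul (Q.hasDerivAt _)
  have h2' : HasDerivAt (fun z : ℂ => z ^ a * Q.eval z)
      ((a * (w : ℂ) ^ (a - 1)) * Q.eval (w : ℂ) + (w : ℂ) ^ a * Q.derivative.eval (w : ℂ))
      ((w * Circle.exp 0 : Circle) : ℂ) := by simpa using h2
  have h3 := h2'.comp (0:ℝ) h1
  refine h3.congr_deriv ?_
  rw [zpow_sub_one₀ hw]
  field_simp

lemma deg_aux {m : ℕ} {Q : ℂ[X]} (hQ : Q ∈ degreeLT ℂ (m + 1)) (a : ℂ) :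
    C a * Q + X * derivative Q ∈ degreeLT ℂ (m + 1) := by
  rw [mem_degreeLT, degree_lt_iff_coeff_zero] at *
  intro k hk
  rcases k with _ | k
  · omega
  · simp [coeff_derivative, hQ (k + 1) hk]

lemma deg_X {m : ℕ} {Q : ℂ[X]} (hQ : Q ∈ degreeLT ℂ (m + 1)) :
    X * Q ∈ degreeLT ℂ (m + 2) := by
  rw [mem_degreeLT, degree_lt_iff_coeff_zero] at *
  intro k hk
  rcases k with _ | k
  · omega
  · simp [hQ k (by omega)]

lemma deg_up {m : ℕ} {Q : ℂ[X]} (hQ : Q ∈ degreeLT ℂ (m + 1)) :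
    Q ∈ degreeLT ℂ (m + 2) := degreeLT_mono (by omega) hQ

lemma deg_C {m : ℕ} {Q : ℂ[X]} (hQ : Q ∈ degreeLT ℂ m) (c : ℂ) :
    C c * Q ∈ degreeLT ℂ m := by
  rw [← smul_eq_C_mul]; exact Submodule.smul_mem _ _ hQ

lemma spec_step {I : Set ℝ} (hI : IsOpen I) {g g' : ℝ → ℂ} {r : ℝ} (hr : 0 < r) {U : Set ℂ}
    (hU : IsOpen U) (hg : ∀ s, HasDerivAt g (g' s) s) (hg1 : ∀ s, ‖g' s‖ = 1)
    (hIU : ∀ s ∈ I, ∀ w : Circle, g s + r * w ∈ U)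
    {a : ℤ} {m : ℕ} {f : ℂ → ℂ} (hf : ContDiffOn ℝ (⊤ : ℕ∞) f U)
    (h : Spec I g r a (m + 1) f) : Spec I g r a m (dz f) ∧ Spec I g r (a + 1) m (db f) := by
  have main : ∀ s ∈ I, 
      (∃ Q ∈ degreeLT ℂ m, ∀ w : Circle, dz f (g s + r * w) = (w : ℂ) ^ a * Q.eval (w : ℂ)) ∧
      (∃ Q ∈ degreeLT ℂ m, ∀ w : Circle, db f (g s + r * w) = (w : ℂ) ^ (a + 1) * Q.eval (w : ℂ)) := by
    intro s hs
    obtain ⟨Q, hQ, hq⟩ := h s hs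
    have hrC : (r : ℂ) ≠ 0 := by exact_mod_cast hr.ne'
    let u : Circle := ⟨g' s, by simp [Submonoid.unitSphere, hg1]⟩
    have hu : (u : ℂ) = g' s := rfl
    have hcu : (starRingEnd ℂ (u : ℂ)) = (u : ℂ)⁻¹ := by
      rw [← Circle.coe_inv_eq_conj, Circle.coe_inv]
    have hu0 : (u : ℂ) ≠ 0 := u.coe_ne_zero
    -- s derivative
    have hD : ∀ w : Circle, HasDerivAt (fun t : ℝ => f (g t + r * w))
        (u * dz f (g s + r * w) + (u : ℂ)⁻¹ * db f (g s + r * w)) s := by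
      intro w
      have h1 := (hasd hU hf (hIU s hs w)).comp_hasDerivAt s ((hg s).add_const ((r : ℂ) * w))
      rw [fderiv_eq, ← hu, hcu] at h1
      exact h1
    obtain ⟨T, hT, hTq⟩ := deriv_spec hI h hs hD
    -- phi derivative
    have hP : ∀ w : Circle, (w : ℂ) ^ a * (Complex.I * (a * Q.eval (w : ℂ) + w * Q.derivative.eval (w : ℂ)))
        = r * Complex.I * (w * dz f (g s + r * w) - (w : ℂ)⁻¹ * db f (g s + r * w)) := by
      intro w
      have h1 : HasDerivAt (fun t : ℝ => g s + r * ((w * Circle.exp t : Circle) : ℂ))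
          (r * (w * Complex.I)) 0 := by
        have := ((Complex.ofRealCLM.hasDerivAt (x := (0:ℝ))).mul_const Complex.I).cexp
        simpa using ((this.const_mul (w : ℂ)).const_mul (r : ℂ)).const_add (g s)
      have h2 : HasFDerivAt f (fderiv ℝ f (g s + r * w)) (g s + r * ((w * Circle.exp 0 : Circle) : ℂ)) := by
        simpa using hasd hU hf (hIU s hs w)
      have h3 := h2.comp_hasDerivAt (0:ℝ) h1
      have h4 := phi_deriv Q a w
      have h5 : (fun t : ℝ => ((w * Circle.exp t : Circle) : ℂ) ^ a
          * Q.eval ((w * Circle.exp t : Circle) : ℂ)) =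
          f ∘ (fun t : ℝ => g s + r * ((w * Circle.exp t : Circle) : ℂ)) := by
        ext t; exact (hq _).symm
      rw [h5] at h4
      rw [h4.unique h3, fderiv_eq]
      have hcw : (starRingEnd ℂ (w : ℂ)) = (w : ℂ)⁻¹ := by
        rw [← Circle.coe_inv_eq_conj, Circle.coe_inv]
      simp only [map_mul, hcw, Complex.conj_I, Complex.conj_ofReal]
      ring
    have hcc : Continuous fun w : Circle => g s + r * (w : ℂ) := by fun_prop
    have c1 : Continuous fun w : Circle => dz f (g s + r * w) :=
      (dz_smooth hU hf).continuousOn.comp_continuous hcc (hIU s hs)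
    have c2 : Continuous fun w : Circle => db f (g s + r * w) :=
      (db_smooth hU hf).continuousOn.comp_continuous hcc (hIU s hs)
    have hA := deg_aux hQ (a : ℂ)
    constructor
    · refine div_step c1 u (R := C ((r : ℂ)⁻¹) * (X * (C (a : ℂ) * Q + X * derivative Q))
        + C (u : ℂ) * T) ?_ ?_
      · exact Submodule.add_mem _ (deg_C (deg_X hA) _) (deg_C (deg_up hT) _)
      · intro w
        have hw : (w : ℂ) ≠ 0 := w.coe_ne_zero
        have e1 := hP w
        have e2 := hTq w
        simp only [eval_add, eval_mul, eval_C, eval_X]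
        have e1' : (w : ℂ) ^ a * (a * Q.eval (w : ℂ) + w * Q.derivative.eval (w : ℂ))
          = r * (w * dz f (g s + r * w) - (w : ℂ)⁻¹ * db f (g s + r * w)) := by
          apply mul_left_cancel₀ Complex.I_ne_zero
          linear_combination e1
        have e3 : (w : ℂ) ^ a * ((r : ℂ)⁻¹ * (w * (a * eval (w : ℂ) Q + w * eval (w : ℂ) (derivative Q)))
            + u * eval (w : ℂ) T) = (r : ℂ)⁻¹ * w * ((w : ℂ) ^ a * (a * Q.eval (w : ℂ) + w * Q.derivative.eval (w : ℂ))) + u * ((w : ℂ) ^ a * eval (w : ℂ) T) := by ring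
        rw [e3, e1', ← e2]
        field_simp
        ring
    · refine div_step c2 u (R := C (-(r : ℂ)⁻¹ * u ^ 2) * ((C (a : ℂ) * Q + X * derivative Q))
        + C (u : ℂ) * (X * T)) ?_ ?_
      · exact Submodule.add_mem _ (deg_C (deg_up hA) _) (deg_C (deg_X hT) _)
      · intro w
        have hw : (w : ℂ) ≠ 0 := w.coe_ne_zero
        have e1 := hP w
        have e2 := hTq w
        simp only [eval_add, eval_mul, eval_C, eval_X]
        have e1' : (w : ℂ) ^ a * (a * Q.eval (w : ℂ) + w * Q.derivative.eval (w : ℂ))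
          = r * (w * dz f (g s + r * w) - (w : ℂ)⁻¹ * db f (g s + r * w)) := by
          apply mul_left_cancel₀ Complex.I_ne_zero
          linear_combination e1
        have e3 : (w : ℂ) ^ (a + 1) * (-(r : ℂ)⁻¹ * u ^ 2 * ((a * eval (w : ℂ) Q + w * eval (w : ℂ) (derivative Q)))
            + u * (w * eval (w : ℂ) T)) = -(r : ℂ)⁻¹ * u ^ 2 * w * ((w : ℂ) ^ a * (a * Q.eval (w : ℂ) + w * Q.derivative.eval (w : ℂ))) + u * w ^ 2 * ((w : ℂ) ^ a * eval (w : ℂ) T) := by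
          rw [zpow_add_one₀ hw]; ring
        rw [e3, e1', ← e2]
        field_simp
        ring
  exact ⟨fun s hs => (main s hs).1, fun s hs => (main s hs).2⟩

lemma spec_K {I : Set ℝ} (hI : IsOpen I) {g g' : ℝ → ℂ} {r : ℝ} (hr : 0 < r) {U : Set ℂ}
    (hU : IsOpen U) (hg : ∀ s, HasDerivAt g (g' s) s) (hg1 : ∀ s, ‖g' s‖ = 1)
    (hIU : ∀ s ∈ I, ∀ w : Circle, g s + r * w ∈ U) (m : ℕ) :
    ∀ (a : ℤ) (f : ℂ → ℂ), ContDiffOn ℝ (⊤ : ℕ∞) f U → Spec I g r a m f →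
      K {z | ∃ s ∈ I, ∃ w : Circle, z = g s + r * w} m f := by
  induction m with
  | zero =>
    rintro a f hf h z ⟨s, hs, w, rfl⟩
    obtain ⟨Q, hQ, hq⟩ := h s hs
    have : Q = 0 := by
      rw [mem_degreeLT] at hQ
      simpa using hQ
    rw [hq, this]; simp
  | succ m ih =>
    intro a f hf h
    have := spec_step hI hr hU hg hg1 hIU hf h
    exact ⟨ih _ _ (dz_smooth hU hf) this.1, ih _ _ (db_smooth hU hf) this.2⟩

lemma circ_const {I : Set ℝ} {g : ℝ → ℂ} {r : ℝ} (hr : 0 < r) {U : Set ℂ}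
    (hU : IsOpen U) (hIU : ∀ s ∈ I, ∀ w : Circle, g s + r * w ∈ U) {s₀ : ℝ} (hs₀ : s₀ ∈ I)
    (hd : ∀ s ∈ I, ‖g s - g s₀‖ < 2 * r) {f : ℂ → ℂ} (hf : ContDiffOn ℝ (⊤ : ℕ∞) f U)
    (h : K {z | ∃ s ∈ I, ∃ w : Circle, z = g s + r * w} 1 f) :
    ∃ c, ∀ z ∈ {z | ∃ s ∈ I, ∃ w : Circle, z = g s + r * w}, f z = c := by
  have hc : ∀ s ∈ I, ∀ w w' : Circle, f (g s + r * w) = f (g s + r * w') := by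
    intro s hs
    have hder : ∀ t : ℝ, HasDerivAt (fun t : ℝ => f (g s + r * Complex.exp (t * Complex.I))) 0 t := by
      intro t
      have h1 : HasDerivAt (fun t : ℝ => g s + r * Complex.exp (t * Complex.I)) _ t :=
        ((((Complex.ofRealCLM.hasDerivAt (x := t)).mul_const Complex.I).cexp).const_mul (r : ℂ)).const_add (g s)
      have hm := hIU s hs (Circle.exp t)
      rw [Circle.coe_exp] at hm
      have h3 := (hasd hU hf hm).comp_hasDerivAt t h1
      refine h3.congr_deriv ?_
      have hA : (g s + r * Complex.exp (t * Complex.I)) ∈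
          {z | ∃ s ∈ I, ∃ w : Circle, z = g s + r * w} := ⟨s, hs, Circle.exp t, by simp⟩
      rw [fderiv_eq, h.1 _ hA, h.2 _ hA]
      simp
    have hcst := is_const_of_deriv_eq_zero (fun t => (hder t).differentiableAt) (fun t => (hder t).deriv)
    intro w w'
    have := hcst (Complex.arg w) (Complex.arg w')
    simpa only [← Circle.coe_exp, Circle.exp_arg] using this
  refine ⟨f (g s₀ + r * (1 : Circle)), ?_⟩
  rintro z ⟨s, hs, w, rfl⟩
  have hrC : (r : ℂ) ≠ 0 := by exact_mod_cast hr.ne'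
  -- intersection point
  have hint : ∃ w1 w2 : Circle, g s + r * w1 = g s₀ + r * w2 := by
    have hd := hd s hs
    by_cases hz : g s - g s₀ = 0
    · exact ⟨1, 1, by rw [sub_eq_zero.mp hz]⟩
    set d := g s - g s₀ with hdd
    have hdpos : 0 < ‖d‖ := norm_pos_iff.mpr hz
    let t : ℝ := √(r ^ 2 / ‖d‖ ^ 2 - 1 / 4)
    have ht : t ^ 2 = r ^ 2 / ‖d‖ ^ 2 - 1 / 4 := by
      apply Real.sq_sqrt
      rw [sub_nonneg, le_div_iff₀ (by positivity)]
      nlinarith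
    have hn : ∀ e : ℝ, e ^ 2 = 1 / 4 → ‖d * (e + t * Complex.I) / r‖ = 1 := by
      intro e he
      have : ‖((e : ℂ) + t * Complex.I)‖ = r / ‖d‖ := by
        rw [Complex.norm_add_mul_I, he, ht]
        rw [show (1 / 4 + (r ^ 2 / ‖d‖ ^ 2 - 1 / 4)) = (r / ‖d‖) ^ 2 by field_simp; ring]
        exact Real.sqrt_sq (by positivity)
      rw [norm_div, norm_mul, this, Complex.norm_real, Real.norm_of_nonneg hr.le]
      field_simp
    refine ⟨⟨_, mem_sphere_zero_iff_norm.mpr (hn (-(1/2)) (by norm_num))⟩,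
      ⟨_, mem_sphere_zero_iff_norm.mpr (hn (1/2) (by norm_num))⟩, ?_⟩
    change g s + r * (d * (((-(1/2) : ℝ) : ℂ) + t * Complex.I) / r) =
      g s₀ + r * (d * (((1/2 : ℝ) : ℂ) + t * Complex.I) / r)
    rw [mul_div_cancel₀ _ hrC, mul_div_cancel₀ _ hrC]
    rw [hdd]
    push_cast
    ring
  obtain ⟨w1, w2, h12⟩ := hint
  rw [hc s hs w w1, h12, hc s₀ hs₀ w2 1]

def Trig (k : ℕ) (h : Circle → ℂ) : Prop :=
  ∃ Q ∈ degreeLT ℂ (2 * k + 1), ∀ w : Circle, h w = (w : ℂ) ^ (-(k : ℤ)) * Q.eval (w : ℂ)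

lemma Trig.mul {j k : ℕ} {h h' : Circle → ℂ} (a : Trig j h) (b : Trig k h') :
    Trig (j + k) (fun w => h w * h' w) := by
  obtain ⟨P, hP, hp⟩ := a
  obtain ⟨Q, hQ, hq⟩ := b
  refine ⟨P * Q, ?_, fun w => ?_⟩
  · rw [degreeLT_succ_eq_degreeLE, mem_degreeLE] at *
    refine (degree_mul_le _ _).trans ((add_le_add hP hQ).trans ?_)
    norm_cast; omega
  · beta_reduce; rw [hp, hq, eval_mul, Nat.cast_add, neg_add, zpow_add₀ w.coe_ne_zero]; ring

lemma Trig.one : Trig 0 (fun _ => 1) := ⟨1, by rw [mem_degreeLT]; simp, by simp⟩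

lemma Trig.pow {j : ℕ} {h : Circle → ℂ} (a : Trig j h) (n : ℕ) :
    Trig (n * j) (fun w => h w ^ n) := by
  induction n with
  | zero => simpa using Trig.one
  | succ n ih => simpa [pow_succ, add_mul] using ih.mul a

lemma Trig.add {k : ℕ} {h h' : Circle → ℂ} (a : Trig k h) (b : Trig k h') :
    Trig k (fun w => h w + h' w) := by
  obtain ⟨P, hP, hp⟩ := a
  obtain ⟨Q, hQ, hq⟩ := b
  exact ⟨P + Q, Submodule.add_mem _ hP hQ, fun w => by beta_reduce; rw [hp, hq, eval_add]; ring⟩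

lemma Trig.smul {k : ℕ} {h : Circle → ℂ} (a : Trig k h) (c : ℂ) :
    Trig k (fun w => c * h w) := by
  obtain ⟨P, hP, hp⟩ := a
  exact ⟨C c * P, deg_C hP c, fun w => by beta_reduce; rw [hp, eval_mul, eval_C]; ring⟩

lemma Trig.mono {j k : ℕ} (hjk : j ≤ k) {h : Circle → ℂ} (a : Trig j h) : Trig k h := by
  obtain ⟨i, rfl⟩ := Nat.exists_eq_add_of_le hjk
  have : Trig i (fun _ => 1) := by
    refine ⟨X ^ i, ?_, fun w => ?_⟩
    · rw [mem_degreeLT]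
      rw [degree_X_pow]; norm_cast; omega
    · rw [eval_pow, eval_X, zpow_neg, zpow_natCast, inv_mul_cancel₀ (pow_ne_zero _ w.coe_ne_zero)]
  simpa using a.mul this

lemma Trig.sum {ι : Type*} (s : Finset ι) {k : ℕ} {h : ι → Circle → ℂ} (a : ∀ i ∈ s, Trig k (h i)) :
    Trig k (fun w => ∑ i ∈ s, h i w) := by
  classical
  induction s using Finset.induction_on with
  | empty => exact ⟨0, Submodule.zero_mem _, by simp⟩
  | insert i s hi ih =>
    simp only [Finset.sum_insert hi]
    exact (a i (by simp)).add (ih fun j hj => a j (by simp [hj]))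

lemma trig_lin (α β δ : ℂ) : Trig 1 (fun w : Circle => α + β * w + δ * (w : ℂ)⁻¹) := by
  refine ⟨C β * X ^ 2 + C α * X + C δ, ?_, fun w => ?_⟩
  · rw [degreeLT_succ_eq_degreeLE, mem_degreeLE]; exact degree_quadratic_le
  · have hw : (w : ℂ) ≠ 0 := w.coe_ne_zero
    simp; field_simp; ring

lemma trig_poly (c : ℂ) (r : ℝ) (N : ℕ) (p : MvPolynomial (Fin 2) ℝ) (hp : p.totalDegree ≤ N) :
    Trig N (fun w : Circle =>
      ((MvPolynomial.eval ![(c + r * w).re, (c + r * w).im] p : ℝ) : ℂ)) := by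
  have hcw (w : Circle) : (starRingEnd ℂ (w : ℂ)) = (w : ℂ)⁻¹ := by
    rw [← Circle.coe_inv_eq_conj, Circle.coe_inv]
  have h0 : Trig 1 (fun w : Circle => (((c + r * w).re : ℝ) : ℂ)) := by
    have : (fun w : Circle => (((c + r * w).re : ℝ) : ℂ)) =
      fun w : Circle => (c.re : ℂ) + (r / 2 : ℂ) * w + (r / 2 : ℂ) * (w : ℂ)⁻¹ := by
      ext w; rw [← hcw]; apply Complex.ext <;> simp <;> ring
    rw [this]; exact trig_lin _ _ _
  have h1 : Trig 1 (fun w : Circle => (((c + r * w).im : ℝ) : ℂ)) := by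
    have : (fun w : Circle => (((c + r * w).im : ℝ) : ℂ)) =
      fun w : Circle => (c.im : ℂ) + (- (r / 2) * Complex.I : ℂ) * w + (r / 2 * Complex.I : ℂ) * (w : ℂ)⁻¹ := by
      ext w; rw [← hcw]; apply Complex.ext <;> simp <;> ring
    rw [this]; exact trig_lin _ _ _
  simp only [MvPolynomial.eval_eq', Fin.prod_univ_two]
  push_cast
  apply Trig.sum
  intro d hd
  apply Trig.smul
  have hdeg := MvPolynomial.le_totalDegree hd
  rw [Finsupp.sum_fintype _ _ (by simp), Fin.sum_univ_two] at hdeg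
  refine Trig.mono (j := d 0 * 1 + d 1 * 1) (by omega) ?_
  exact (h0.pow (d 0)).mul (h1.pow (d 1))

end PC

/-- Localized version (Lemma 6.1): if a C^∞ function F on a neighborhood of
`A_{s₀,ε} = ⋃_{|s−s₀|≤ε} C_s` (where `C_s = {x : |x − γ(s)| = r}` and 0 < ε < 2r) agrees
on each circle C_s with |s−s₀| < ε with a polynomial of total degree at most N, then F
coincides on A_{s₀,ε} with a polynomial in x₁, x₂ of total degree at most 2N. -/
theorem polynomial_on_circles_local
    (r ε : ℝ) (hr : 0 < r) (hε : 0 < ε) (hε2r : ε < 2 * r)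
    (N : ℕ) (γ : ℝ → EuclideanSpace ℝ (Fin 2))
    (hγ : ContDiff ℝ (⊤ : ℕ∞) γ) (hunit : ∀ s, ‖deriv γ s‖ = 1)
    (s₀ : ℝ) (U : Set (EuclideanSpace ℝ (Fin 2))) (hU : IsOpen U)
    (hAU : (⋃ s ∈ {s : ℝ | |s - s₀| ≤ ε}, Metric.sphere (γ s) r) ⊆ U)
    (F : EuclideanSpace ℝ (Fin 2) → ℝ) (hF : ContDiffOn ℝ (⊤ : ℕ∞) F U)
    (hpoly : ∀ s : ℝ, |s - s₀| < ε → ∃ p : MvPolynomial (Fin 2) ℝ, p.totalDegree ≤ N ∧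
      ∀ x ∈ Metric.sphere (γ s) r, F x = MvPolynomial.eval (fun i => x i) p) :
    ∃ P : MvPolynomial (Fin 2) ℝ, P.totalDegree ≤ 2 * N ∧
      ∀ x ∈ ⋃ s ∈ {s : ℝ | |s - s₀| ≤ ε}, Metric.sphere (γ s) r,
        F x = MvPolynomial.eval (fun i => x i) P := by
  classical
  let e : ℂ ≃ₗᵢ[ℝ] EuclideanSpace ℝ (Fin 2) := Complex.orthonormalBasisOneI.repr
  have he0 : ∀ z : ℂ, e z 0 = z.re := fun z => by simp [e]
  have he1 : ∀ z : ℂ, e z 1 = z.im := fun z => by simp [e]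
  have hev : ∀ (z : ℂ) (p : MvPolynomial (Fin 2) ℝ),
      MvPolynomial.eval (fun i => e z i) p = MvPolynomial.eval ![z.re, z.im] p := by
    intro z p
    have h : (fun i => e z i) = ![z.re, z.im] := by
      funext i
      fin_cases i
      · exact he0 z
      · exact he1 z
    rw [h]
  let g : ℝ → ℂ := fun s => e.symm (γ s)
  let g' : ℝ → ℂ := fun s => e.symm (deriv γ s)
  have hγd : ∀ s, HasDerivAt γ (deriv γ s) s := fun s =>
    ((hγ.differentiable (by simp)) s).hasDerivAt
  have hg : ∀ s, HasDerivAt g (g' s) s := fun s =>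
    (e.symm.toContinuousLinearEquiv.toContinuousLinearMap.hasFDerivAt).comp_hasDerivAt s (hγd s)
  have hg1 : ∀ s, ‖g' s‖ = 1 := fun s => by simp [g', hunit]
  let V : Set ℂ := e ⁻¹' U
  have hV : IsOpen V := hU.preimage e.continuous
  let f : ℂ → ℂ := fun z => ((F (e z) : ℝ) : ℂ)
  have hf : ContDiffOn ℝ (⊤ : ℕ∞) f V :=
    Complex.ofRealCLM.contDiff.comp_contDiffOn
      (hF.comp e.toContinuousLinearEquiv.contDiff.contDiffOn (fun z hz => hz))
  have hsph : ∀ s (w : Circle), e (g s + r * w) ∈ Metric.sphere (γ s) r := by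
    intro s w
    rw [mem_sphere_iff_norm]
    have : γ s = e (g s) := by simp [g]
    rw [this, ← map_sub, e.norm_map]
    rw [add_sub_cancel_left, norm_mul, Circle.norm_coe, mul_one, Complex.norm_real,
      Real.norm_of_nonneg hr.le]
  let J : Set ℝ := Set.Ioo (s₀ - ε) (s₀ + ε)
  have hJ : ∀ s ∈ J, |s - s₀| < ε := fun s hs => by
    rw [abs_lt]; constructor <;> linarith [hs.1, hs.2]
  have hIU : ∀ s ∈ J, ∀ w : Circle, g s + r * w ∈ V := by
    intro s hs w
    refine hAU ?_
    simp only [Set.mem_iUnion]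
    exact ⟨s, (hJ s hs).le, hsph s w⟩
  have hspec : PC.Spec J g r (-(N : ℤ)) (2 * N + 1) f := by
    intro s hs
    obtain ⟨p, hp, hpe⟩ := hpoly s (hJ s hs)
    obtain ⟨Q, hQ, hq⟩ := PC.trig_poly (g s) r N p hp
    refine ⟨Q, hQ, fun w => ?_⟩
    rw [← hq w]
    simp only [f]
    rw [hpe _ (hsph s w), hev]
  have hK := PC.spec_K isOpen_Ioo hr hV hg hg1 hIU _ _ f hf hspec
  have hs₀ : s₀ ∈ J := ⟨by linarith, by linarith⟩
  have hlip : ∀ s ∈ J, ‖g s - g s₀‖ < 2 * r := by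
    intro s hs
    have := Convex.norm_image_sub_le_of_norm_hasDerivWithin_le (f := g) (f' := g') (s := Set.univ)
      (C := 1) (fun x _ => (hg x).hasDerivWithinAt) (fun x _ => (hg1 x).le) convex_univ
      (Set.mem_univ s₀) (Set.mem_univ s)
    rw [one_mul, Real.norm_eq_abs] at this
    linarith [hJ s hs]
  have hA : {z | ∃ s ∈ J, ∃ w : Circle, z = g s + r * w} ⊆ V := by
    rintro z ⟨s, hs, w, rfl⟩
    exact hIU s hs w
  obtain ⟨P, Q, hP, -, hPQ⟩ := PC.K_poly hV hA
    (fun f hf h => PC.circ_const hr hV hIU hs₀ hlip hf h) (2 * N) hf hK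
  have hopen : ∀ s ∈ J, ∀ x ∈ Metric.sphere (γ s) r,
      F x = MvPolynomial.eval (fun i => x i) P := by
    intro s hs x hx
    have hw : ‖(e.symm x - g s) / r‖ = 1 := by
      have : e.symm x - g s = e.symm (x - γ s) := by simp [g]
      rw [this, norm_div, e.symm.norm_map, mem_sphere_iff_norm.mp hx]
      simp [abs_of_pos hr, hr.ne']
    have hrC : (r : ℂ) ≠ 0 := by exact_mod_cast hr.ne'
    have hmem : e.symm x ∈ {z | ∃ s ∈ J, ∃ w : Circle, z = g s + r * w} := by
      refine ⟨s, hs, ⟨_, mem_sphere_zero_iff_norm.mpr hw⟩, ?_⟩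
      change e.symm x = g s + r * ((e.symm x - g s) / r)
      rw [mul_div_cancel₀ _ hrC]; ring
    have h1 := congrArg Complex.re (hPQ _ hmem)
    have h2 := hev (e.symm x) P
    rw [e.apply_symm_apply] at h2
    rw [h2]
    simpa [f, PC.ev] using h1
  refine ⟨P, hP, ?_⟩
  intro x hx
  simp only [Set.mem_iUnion, Set.mem_setOf_eq] at hx
  obtain ⟨s, hs, hx⟩ := hx
  have hv : ∀ t, γ t + (x - γ s) ∈ Metric.sphere (γ t) r := by
    intro t
    rw [mem_sphere_iff_norm, add_sub_cancel_left]
    exact mem_sphere_iff_norm.mp hx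
  have hcont : Continuous fun t => γ t + (x - γ s) := hγ.continuous.add continuous_const
  have hcl : closure J = Set.Icc (s₀ - ε) (s₀ + ε) := closure_Ioo (by linarith)
  have hcF : ContinuousOn (fun t => F (γ t + (x - γ s))) (Set.Icc (s₀ - ε) (s₀ + ε)) := by
    refine hF.continuousOn.comp hcont.continuousOn ?_
    intro t ht
    refine hAU ?_
    simp only [Set.mem_iUnion]
    refine ⟨t, ?_, hv t⟩
    rw [Set.mem_setOf_eq, abs_le]
    constructor <;> linarith [ht.1, ht.2]
  have hcP : Continuous (fun t => MvPolynomial.eval (fun i => (γ t + (x - γ s)) i) P) := by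
    have : Continuous fun t => (fun i => (γ t + (x - γ s)) i : Fin 2 → ℝ) :=
      continuous_pi fun i => (EuclideanSpace.proj (𝕜 := ℝ) i).continuous.comp hcont
    exact (MvPolynomial.continuous_eval P).comp this
  have heq : Set.EqOn (fun t => F (γ t + (x - γ s)))
      (fun t => MvPolynomial.eval (fun i => (γ t + (x - γ s)) i) P) J :=
    fun t ht => hopen t ht _ (hv t)
  have hfin := heq.of_subset_closure hcF hcP.continuousOn Set.Ioo_subset_Icc_self hcl.ge
  have hsI : s ∈ Set.Icc (s₀ - ε) (s₀ + ε) := by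
    rw [abs_le] at hs
    constructor <;> linarith [hs.1, hs.2]
  simpa using hfin hsI
end

section
/- Let P ∈ ℂ[X,Y,Z] be a homogeneous polynomial of degree m ≥ 1, and let (x₀, y₀) ∈ ℂ² satisfy x₀² + y₀² ≠ 0, P(x₀, y₀, 0) = 0, and (∂P/∂X)(x₀,y₀,0)² + (∂P/∂Y)(x₀,y₀,0)² = 0. Then (∂P/∂X)(x₀,y₀,0) = 0 and (∂P/∂Y)(x₀,y₀,0) = 0. -/
/-- Points at infinity (Theorem 5.2, algebraic core): if P ∈ ℂ[X,Y,Z] is homogeneous of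
degree m ≥ 1, the point (x₀ : y₀ : 0) is non-isotropic (x₀² + y₀² ≠ 0), lies on {P = 0},
and P_X² + P_Y² vanishes there, then both P_X and P_Y vanish there. -/
theorem infinite_point_tangency
    (m : ℕ) (hm : 1 ≤ m) (P : MvPolynomial (Fin 3) ℂ)
    (hP : P.IsHomogeneous m) (x₀ y₀ : ℂ) (hxy : x₀ ^ 2 + y₀ ^ 2 ≠ 0)
    (hval : MvPolynomial.eval ![x₀, y₀, 0] P = 0)
    (hiso : (MvPolynomial.eval ![x₀, y₀, 0] (MvPolynomial.pderiv 0 P)) ^ 2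
          + (MvPolynomial.eval ![x₀, y₀, 0] (MvPolynomial.pderiv 1 P)) ^ 2 = 0) :
    MvPolynomial.eval ![x₀, y₀, 0] (MvPolynomial.pderiv 0 P) = 0 ∧
    MvPolynomial.eval ![x₀, y₀, 0] (MvPolynomial.pderiv 1 P) = 0 := by
  have hE := congrArg (MvPolynomial.eval ![x₀, y₀, 0]) hP.sum_X_mul_pderiv
  simp only [Fin.sum_univ_three, map_add, map_mul, map_nsmul, MvPolynomial.eval_X, hval,
    smul_zero] at hE
  generalize MvPolynomial.eval ![x₀, y₀, 0] (MvPolynomial.pderiv 0 P) = a at *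
  generalize MvPolynomial.eval ![x₀, y₀, 0] (MvPolynomial.pderiv 1 P) = b at *
  have hE' : x₀ * a + y₀ * b = 0 := by simpa using hE
  constructor
  · have h : (x₀ ^ 2 + y₀ ^ 2) * a ^ 2 = 0 := by
      linear_combination (x₀ * a - y₀ * b) * hE' + y₀ ^ 2 * hiso
    simpa [hxy] using h
  · have h : (x₀ ^ 2 + y₀ ^ 2) * b ^ 2 = 0 := by
      linear_combination (y₀ * b - x₀ * a) * hE' + x₀ ^ 2 * hiso
    simpa [hxy] using h
end

section
/- Let d₀ ∈ ℝ and let ρ₁ : ℝ → ℝ be a continuously differentiable 2π-periodic function satisfying, for every x ∈ ℝ, cos(d₀)·(ρ₁(x + d₀) − ρ₁(x − d₀)) = sin(d₀)·(ρ₁'(x + d₀) + ρ₁'(x − d₀)). Then for every integer n such that cos(d₀) sin(n d₀) ≠ n sin(d₀) cos(n d₀), the n-th Fourier coefficient of ρ₁ vanishes: ∫_0^{2π} ρ₁(x) e^{−inx} dx = 0. Equivalently, the only Fourier modes that can appear in ρ₁ are those n satisfying the Gutkin relation tan(n d₀) = n tan(d₀). -/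
open Real

lemma gutkin_exp_periodic (n : ℤ) :
    Function.Periodic (fun x : ℝ => Complex.exp (-(n * x) * Complex.I)) (2 * π) := by
  intro x
  have : (-(n * ((x + 2 * π : ℝ) : ℂ)) * Complex.I)
      = -(n * x) * Complex.I + ((-n : ℤ) : ℂ) * (2 * π * Complex.I) := by
    push_cast; ring
  simp only [this, Complex.exp_add, Complex.exp_int_mul_two_pi_mul_I, mul_one]

lemma gutkin_shift (n : ℤ) (d : ℝ) (g : ℝ → ℝ) (hg : Function.Periodic g (2 * π)) :
    (∫ x in (0 : ℝ)..(2 * π), (g (x + d) : ℂ) * Complex.exp (-(n * x) * Complex.I)) =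
      Complex.exp (n * d * Complex.I) *
        ∫ x in (0 : ℝ)..(2 * π), (g x : ℂ) * Complex.exp (-(n * x) * Complex.I) := by
  set F : ℝ → ℂ := fun x => (g x : ℂ) * Complex.exp (-(n * x) * Complex.I) with hF
  have hFp : Function.Periodic F (2 * π) := by
    intro x
    have h := gutkin_exp_periodic n x
    simp only [] at h
    simp only [hF, hg x, h]
  have h1 : ∀ x : ℝ, (g (x + d) : ℂ) * Complex.exp (-(n * x) * Complex.I)
      = Complex.exp (n * d * Complex.I) * F (x + d) := by
    intro x
    have : Complex.exp (-(n * x) * Complex.I) = Complex.exp (n * d * Complex.I) *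
        Complex.exp (-(n * ((x + d : ℝ) : ℂ)) * Complex.I) := by
      rw [← Complex.exp_add]; congr 1; push_cast; ring
    simp only [hF]
    rw [this]; ring
  simp_rw [h1]
  rw [intervalIntegral.integral_const_mul, intervalIntegral.integral_comp_add_right]
  have := hFp.intervalIntegral_add_eq d 0
  rw [zero_add] at this
  rw [zero_add, add_comm (2 * π) d, this]

lemma gutkin_parts (n : ℤ) (g : ℝ → ℝ) (hC : ContDiff ℝ 1 g) (hg : Function.Periodic g (2 * π)) :
    (∫ x in (0 : ℝ)..(2 * π), ((deriv g x : ℝ) : ℂ) * Complex.exp (-(n * x) * Complex.I)) =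
      n * Complex.I *
        ∫ x in (0 : ℝ)..(2 * π), (g x : ℂ) * Complex.exp (-(n * x) * Complex.I) := by
  have hd : Continuous (deriv g) := hC.continuous_deriv (by norm_num)
  have hu : ∀ x ∈ Set.uIcc (0 : ℝ) (2 * π),
      HasDerivAt (fun x : ℝ => (g x : ℂ)) ((deriv g x : ℝ) : ℂ) x := fun x _ =>
    ((hC.differentiable (by norm_num)) x).hasDerivAt.ofReal_comp
  have hv : ∀ x ∈ Set.uIcc (0 : ℝ) (2 * π),
      HasDerivAt (fun x : ℝ => Complex.exp (-(n * x) * Complex.I))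
        (Complex.exp (-(n * x) * Complex.I) * (-(n * 1) * Complex.I)) x := fun x _ =>
    ((((hasDerivAt_id x).ofReal_comp.const_mul (n : ℂ)).neg).mul_const Complex.I).cexp
  have key := intervalIntegral.integral_mul_deriv_eq_deriv_mul hu hv
    (Continuous.intervalIntegrable (by fun_prop) _ _)
    (Continuous.intervalIntegrable (by fun_prop) _ _)
  have h0 := gutkin_exp_periodic n 0
  have h1 := hg 0
  simp only [zero_add] at h0 h1
  rw [h0, h1, sub_self, zero_sub] at key
  have h2 : ∀ x : ℝ, (g x : ℂ) * (Complex.exp (-(n * x) * Complex.I) * (-(n * 1) * Complex.I))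
      = -(n * Complex.I) * ((g x : ℂ) * Complex.exp (-(n * x) * Complex.I)) := by
    intro x; ring
  simp_rw [h2] at key
  rw [intervalIntegral.integral_const_mul] at key
  linear_combination key

/-- Proposition 3.4(b): a C¹, 2π-periodic solution ρ₁ of the linearized Gutkin equation
`cos d₀ (ρ₁(x+d₀) − ρ₁(x−d₀)) = sin d₀ (ρ₁'(x+d₀) + ρ₁'(x−d₀))` can only contain the
Fourier modes n with `tan(n d₀) = n tan d₀`: for every integer n with
`cos d₀ sin(n d₀) ≠ n sin d₀ cos(n d₀)`, the n-th Fourier coefficient of ρ₁ vanishes. -/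
theorem linearized_gutkin_fourier_modes
    (d₀ : ℝ) (ρ₁ : ℝ → ℝ) (hρ : ContDiff ℝ 1 ρ₁)
    (hper : Function.Periodic ρ₁ (2 * π))
    (heq : ∀ x : ℝ, Real.cos d₀ * (ρ₁ (x + d₀) - ρ₁ (x - d₀)) =
      Real.sin d₀ * (deriv ρ₁ (x + d₀) + deriv ρ₁ (x - d₀))) :
    ∀ n : ℤ, Real.cos d₀ * Real.sin (n * d₀) ≠ n * Real.sin d₀ * Real.cos (n * d₀) →
      (∫ x in (0 : ℝ)..(2 * π), (ρ₁ x : ℂ) * Complex.exp (-(n * x) * Complex.I)) = 0 := by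
  intro n hn
  have hd : Continuous (deriv ρ₁) := hρ.continuous_deriv (by norm_num)
  have hc : Continuous ρ₁ := hρ.continuous
  have hdp : Function.Periodic (deriv ρ₁) (2 * π) := by
    intro x
    rw [← deriv_comp_add_const]
    congr 1
    exact funext hper
  have a1 := gutkin_shift n d₀ ρ₁ hper
  have a2 := gutkin_shift n (-d₀) ρ₁ hper
  have b1 := gutkin_shift n d₀ _ hdp
  have b2 := gutkin_shift n (-d₀) _ hdp
  rw [gutkin_parts n ρ₁ hρ hper] at b1 b2
  set A := ∫ x in (0 : ℝ)..(2 * π), (ρ₁ x : ℂ) * Complex.exp (-(n * x) * Complex.I) with hA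
  have hI : (∫ x in (0 : ℝ)..(2 * π), (Real.cos d₀ : ℂ) *
        ((ρ₁ (x + d₀) : ℂ) * Complex.exp (-(n * x) * Complex.I)
          - (ρ₁ (x + -d₀) : ℂ) * Complex.exp (-(n * x) * Complex.I)))
      = ∫ x in (0 : ℝ)..(2 * π), (Real.sin d₀ : ℂ) *
        (((deriv ρ₁ (x + d₀) : ℝ) : ℂ) * Complex.exp (-(n * x) * Complex.I)
          + ((deriv ρ₁ (x + -d₀) : ℝ) : ℂ) * Complex.exp (-(n * x) * Complex.I)) := by
    congr 1
    funext x
    have h := congrArg (fun t : ℝ => (t : ℂ)) (heq x)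
    simp only [Complex.ofReal_mul, Complex.ofReal_sub, Complex.ofReal_add, sub_eq_add_neg x] at h
    linear_combination Complex.exp (-(n * x) * Complex.I) * h
  rw [intervalIntegral.integral_const_mul, intervalIntegral.integral_const_mul,
    intervalIntegral.integral_sub (Continuous.intervalIntegrable (by fun_prop) _ _)
      (Continuous.intervalIntegrable (by fun_prop) _ _),
    intervalIntegral.integral_add (Continuous.intervalIntegrable (by fun_prop) _ _)
      (Continuous.intervalIntegrable (by fun_prop) _ _), a1, a2, b1, b2] at hI
  have e1 : Complex.exp (n * d₀ * Complex.I)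
      = (Real.cos (n * d₀) : ℂ) + (Real.sin (n * d₀) : ℂ) * Complex.I := by
    rw [Complex.exp_mul_I]; push_cast; rfl
  have e2 : Complex.exp (n * ((-d₀ : ℝ) : ℂ) * Complex.I)
      = (Real.cos (n * d₀) : ℂ) - (Real.sin (n * d₀) : ℂ) * Complex.I := by
    rw [Complex.exp_mul_I]; push_cast
    rw [mul_neg, Complex.cos_neg, Complex.sin_neg]; ring
  rw [e1, e2] at hI
  have hz : ((Real.cos d₀ * Real.sin (n * d₀) - n * Real.sin d₀ * Real.cos (n * d₀) : ℝ) : ℂ)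
      ≠ 0 := Complex.ofReal_ne_zero.mpr (sub_ne_zero.mpr hn)
  have hfin : (2 * Complex.I *
      ((Real.cos d₀ * Real.sin (n * d₀) - n * Real.sin d₀ * Real.cos (n * d₀) : ℝ) : ℂ)) * A
      = 0 := by
    simp only [Complex.ofReal_mul, Complex.ofReal_sub, Complex.ofReal_intCast]
    linear_combination hI
  exact (mul_eq_zero.mp hfin).resolve_left
    (mul_ne_zero (mul_ne_zero two_ne_zero Complex.I_ne_zero) hz)
end
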